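/- arXiv:1503.02245 — 8 statements merged into one kernel-verified Lean document; each statement's English description precedes it below -/
import Mathlib

section
/- Let A and B be right ideals of a right a-ring R with A ∩ B = 0, and let φ : A → B be a nonzero R-module homomorphism. Then φ(A) is contained in the socle of B; in particular φ(A) is a semisimple module. If moreover B is uniform, then φ(A) is a simple module. -/
/-- A module `M` over a ring `A` is *automorphism-invariant* if every injective
`A`-linear map from a submodule of `M` into `M` extends to an endomorphism of `M`. -/
def IsAutomorphismInvariant (A : Type*) [Ring A] (M : Type*) [AddCommGroup M]
    [Module A M] : Prop :=
  ∀ (N : Submodule A M) (f : N →ₗ[A] M), Function.Injective f →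
    ∃ g : M →ₗ[A] M, ∀ n : N, g n = f n

/-- A module `M` over a ring `A` is *quasi-injective* if every `A`-linear map
from a submodule of `M` into `M` extends to an endomorphism of `M`. -/
def IsQuasiInjective (A : Type*) [Ring A] (M : Type*) [AddCommGroup M]
    [Module A M] : Prop :=
  ∀ (N : Submodule A M) (f : N →ₗ[A] M), ∃ g : M →ₗ[A] M, ∀ n : N, g n = f n

/-- Right ideals of `R` are the `Rᵐᵒᵖ`-submodules of `R`.  A ring `R` is a *right
`a`-ring* if every right ideal of `R` is automorphism-invariant as a right `R`-module
(i.e. as an `Rᵐᵒᵖ`-module). -/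
def IsRightARing (R : Type*) [Ring R] : Prop :=
  ∀ I : Submodule Rᵐᵒᵖ R, IsAutomorphismInvariant Rᵐᵒᵖ I

/-- A ring `R` is a *right `q`-ring* if every right ideal of `R` is quasi-injective
as a right `R`-module. -/
def IsRightQRing (R : Type*) [Ring R] : Prop :=
  ∀ I : Submodule Rᵐᵒᵖ R, IsQuasiInjective Rᵐᵒᵖ I

/-- A right ideal is *essential* if it intersects every nonzero right ideal
nontrivially. -/
def IsEssentialRightIdeal (R : Type*) [Ring R] (I : Submodule Rᵐᵒᵖ R) : Prop :=
  ∀ J : Submodule Rᵐᵒᵖ R, I ⊓ J = ⊥ → J = ⊥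

/-- The right ideal `eR` generated by an element `e`. -/
def rightIdealOf (R : Type*) [Ring R] (e : R) : Submodule Rᵐᵒᵖ R where
  carrier := {x : R | ∃ r : R, x = e * r}
  zero_mem' := ⟨0, by simp⟩
  add_mem' := by rintro x y ⟨r, rfl⟩ ⟨s, rfl⟩; exact ⟨r + s, by rw [mul_add]⟩
  smul_mem' := by
    rintro c x ⟨r, rfl⟩
    exact ⟨r * c.unop, by rw [MulOpposite.smul_eq_mul_unop, mul_assoc]⟩

/-- The right annihilator of an element `a` of `R`, as a right ideal. -/
def rightAnnihilator (R : Type*) [Ring R] (a : R) : Submodule Rᵐᵒᵖ R where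
  carrier := {r : R | a * r = 0}
  zero_mem' := by simp
  add_mem' := by
    intro x y hx hy
    simp only [Set.mem_setOf_eq] at *
    rw [mul_add, hx, hy, add_zero]
  smul_mem' := by
    intro c x hx
    simp only [Set.mem_setOf_eq] at *
    rw [MulOpposite.smul_eq_mul_unop, ← mul_assoc, hx, zero_mul]

/-- The socle of a module: the sum of all its simple submodules. -/
def moduleSocle (A : Type*) [Ring A] (M : Type*) [AddCommGroup M] [Module A M] :
    Submodule A M :=
  sSup {N : Submodule A M | IsSimpleModule A N}

/-- A module is *square-free* if it contains no pair of nonzero independent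
isomorphic submodules (equivalently, no nonzero submodule isomorphic to `X ⊕ X`). -/
def IsSquareFreeModule (A : Type*) [Ring A] (M : Type*) [AddCommGroup M]
    [Module A M] : Prop :=
  ∀ N₁ N₂ : Submodule A M, N₁ ⊓ N₂ = ⊥ → Nonempty ((N₁ : Type _) ≃ₗ[A] N₂) → N₁ = ⊥

/-- A module `M` is *square-full* if every nonzero submodule of `M` contains a
nonzero submodule `N` such that `N ⊕ N` embeds in `M`. -/
def IsSquareFullModule (A : Type*) [Ring A] (M : Type*) [AddCommGroup M]
    [Module A M] : Prop :=
  ∀ U : Submodule A M, U ≠ ⊥ → ∃ N N₁ N₂ : Submodule A M, N ≠ ⊥ ∧ N ≤ U ∧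
    N₁ ⊓ N₂ = ⊥ ∧ Nonempty ((N : Type _) ≃ₗ[A] N₁) ∧ Nonempty ((N : Type _) ≃ₗ[A] N₂)

/-- A *CS module*: every submodule is essential in a direct summand. -/
def IsCSModule (A : Type*) [Ring A] (M : Type*) [AddCommGroup M] [Module A M] : Prop :=
  ∀ N : Submodule A M, ∃ D : Submodule A M, (∃ D' : Submodule A M, IsCompl D D') ∧
    N ≤ D ∧ ∀ K : Submodule A M, K ≤ D → K ⊓ N = ⊥ → K = ⊥

/-- A *weak CS module*: every semisimple submodule is essential in a direct summand. -/
def IsWeakCSModule (A : Type*) [Ring A] (M : Type*) [AddCommGroup M] [Module A M] : Prop :=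
  ∀ N : Submodule A M, IsSemisimpleModule A N → ∃ D : Submodule A M,
    (∃ D' : Submodule A M, IsCompl D D') ∧ N ≤ D ∧
      ∀ K : Submodule A M, K ≤ D → K ⊓ N = ⊥ → K = ⊥

/-- A *uniform module*: nonzero, and any two nonzero submodules intersect
nontrivially. -/
def IsUniformModule (A : Type*) [Ring A] (M : Type*) [AddCommGroup M] [Module A M] : Prop :=
  (⊤ : Submodule A M) ≠ ⊥ ∧ ∀ N₁ N₂ : Submodule A M, N₁ ≠ ⊥ → N₂ ≠ ⊥ → N₁ ⊓ N₂ ≠ ⊥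

/-- A ring is *semiprime* if it has no nonzero nilpotent two-sided ideal. -/
def IsSemiprimeRing (R : Type*) [Ring R] : Prop :=
  ∀ I : TwoSidedIdeal R, (∃ n : ℕ, n ≠ 0 ∧
    ∀ l : List R, l.length = n → (∀ x ∈ l, x ∈ I) → l.prod = 0) → I = ⊥

/-- A ring is *prime* if the product of any two nonzero two-sided ideals is nonzero. -/
def IsPrimeRing (R : Type*) [Ring R] : Prop :=
  ∀ I J : TwoSidedIdeal R, I ≠ ⊥ → J ≠ ⊥ → ∃ x ∈ I, ∃ y ∈ J, x * y ≠ 0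

/-- A ring is *von Neumann regular* if every element `a` satisfies `a = a * b * a`
for some `b`. -/
def IsVonNeumannRegularRing (R : Type*) [Ring R] : Prop :=
  ∀ a : R, ∃ b : R, a = a * b * a

/-- Automorphism-invariance is preserved by linear equivalences. -/
theorem IsAutomorphismInvariant.of_equiv {A M N : Type*} [Ring A] [AddCommGroup M] [Module A M]
    [AddCommGroup N] [Module A N] (e : M ≃ₗ[A] N) (hN : IsAutomorphismInvariant A N) :
    IsAutomorphismInvariant A M := by
  intro K f hf
  let eK : K ≃ₗ[A] K.map (e : M →ₗ[A] N) := e.submoduleMap K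
  obtain ⟨g, hg⟩ := hN (K.map (e : M →ₗ[A] N)) ((e : M →ₗ[A] N) ∘ₗ f ∘ₗ (eK.symm : _ →ₗ[A] K))
    (e.injective.comp (hf.comp eK.symm.injective))
  refine ⟨(e.symm : N →ₗ[A] M) ∘ₗ g ∘ₗ (e : M →ₗ[A] N), fun n => ?_⟩
  have h := hg (eK n)
  simp only [LinearMap.comp_apply, LinearEquiv.coe_coe, LinearEquiv.symm_apply_apply] at h ⊢
  rw [LinearEquiv.symm_apply_eq]
  exact h

/-- If `E` is an essential submodule of `Y` and `X × E` is automorphism-invariant, then the image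
of every linear map `X → Y` is contained in `E`. -/
theorem IsAutomorphismInvariant.range_le_of_essential {A X Y : Type*} [Ring A]
    [AddCommGroup X] [Module A X] [AddCommGroup Y] [Module A Y] {E : Submodule A Y}
    (hE : ∀ K : Submodule A Y, Disjoint K E → K = ⊥) (hXE : IsAutomorphismInvariant A (X × E))
    (φ : X →ₗ[A] Y) : LinearMap.range φ ≤ E := by
  let N : Submodule A (X × E) := (E.comap φ).comap (LinearMap.fst A X E)
  let ψ : N →ₗ[A] E :=
    (φ ∘ₗ LinearMap.fst A X E ∘ₗ N.subtype).codRestrict E fun n => n.2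
  let f : N →ₗ[A] X × E := N.subtype + LinearMap.inr A X E ∘ₗ ψ
  have hf : Function.Injective f := by
    rw [← LinearMap.ker_eq_bot, LinearMap.ker_eq_bot']
    rintro ⟨⟨x, e⟩, hx⟩ h
    have hx0 : x = 0 := by simpa [f] using congrArg Prod.fst h
    subst hx0
    have he : e + ψ ⟨(0, e), hx⟩ = 0 := congrArg Prod.snd h
    have hψ : ψ ⟨(0, e), hx⟩ = 0 := Subtype.ext (map_zero φ)
    rw [hψ, add_zero] at he
    subst he
    rfl
  obtain ⟨g, hg⟩ := hXE N f hf
  let h : X →ₗ[A] Y := E.subtype ∘ₗ LinearMap.snd A X E ∘ₗ g ∘ₗ LinearMap.inl A X E - φ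
  have hdisj : Disjoint (LinearMap.range h) E := by
    rw [Submodule.disjoint_def]
    rintro _ ⟨x, rfl⟩ hx
    have hφx : φ x ∈ E := by
      have := E.sub_mem (g (x, 0)).2.2 hx
      simpa [h] using this
    have hgx : g (x, 0) = f ⟨(x, 0), hφx⟩ := hg ⟨(x, 0), hφx⟩
    have : ((g (x, 0)).2 : Y) = φ x := by
      rw [hgx]
      exact zero_add (φ x)
    simp [h, this]
  have h0 : h = 0 := LinearMap.range_eq_bot.mp (hE _ hdisj)
  rintro _ ⟨x, rfl⟩
  have hx : ((g (x, 0)).2 : Y) - φ x = 0 := LinearMap.congr_fun h0 x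
  rw [← sub_eq_zero.mp hx]
  exact (g (x, 0)).2.2

/-- Every submodule has a disjoint submodule such that their sum is essential. -/
theorem Submodule.exists_disjoint_essential_sup {A M : Type*} [Ring A] [AddCommGroup M]
    [Module A M] (C : Submodule A M) :
    ∃ D : Submodule A M, Disjoint C D ∧ ∀ K : Submodule A M, Disjoint K (C ⊔ D) → K = ⊥ := by
  obtain ⟨D, hD⟩ := zorn_le₀ {D : Submodule A M | Disjoint C D} fun c hc hchain =>
    ⟨sSup c, hchain.directedOn.disjoint_sSup_right.mpr fun _ hb => hc hb,
      fun _ hz => le_sSup hz⟩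
  refine ⟨D, hD.prop, fun K hK => ?_⟩
  have hdisj : Disjoint C (D ⊔ K) := hD.prop.disjoint_sup_right_of_disjoint_sup_left hK.symm
  have hKD : K ≤ D := le_sup_right.trans (hD.2 hdisj le_sup_left)
  exact hK.eq_bot_of_le (hKD.trans le_sup_right)

/-- A semisimple submodule is contained in the socle. -/
theorem Submodule.le_moduleSocle_of_isSemisimpleModule {A M : Type*} [Ring A] [AddCommGroup M]
    [Module A M] (D : Submodule A M) [IsSemisimpleModule A D] : D ≤ moduleSocle A M := by
  rw [← D.map_subtype_top, ← IsSemisimpleModule.sSup_simples_eq_top A D,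
    Submodule.map_le_iff_le_comap]
  refine sSup_le fun S (hS : IsSimpleModule A S) => ?_
  rw [← Submodule.map_le_iff_le_comap]
  refine le_sSup ?_
  exact IsSimpleModule.congr (Submodule.equivMapOfInjective D.subtype D.subtype_injective S).symm

/-- A nonzero semisimple submodule of a uniform module is simple. -/
theorem IsUniformModule.isSimpleModule_of_isSemisimpleModule {A M : Type*} [Ring A]
    [AddCommGroup M] [Module A M] (hM : IsUniformModule A M) {D : Submodule A M} (hD : D ≠ ⊥)
    [IsSemisimpleModule A D] : IsSimpleModule A D := by
  have : Nontrivial D := Submodule.nontrivial_iff_ne_bot.mpr hD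
  rw [isSimpleModule_iff]
  refine { eq_bot_or_eq_top := fun C => ?_ }
  obtain ⟨C', hC'⟩ := exists_isCompl C
  by_cases hC : C = ⊥
  · exact Or.inl hC
  by_cases hC'0 : C' = ⊥
  · exact Or.inr (eq_top_of_isCompl_bot (hC'0 ▸ hC'))
  refine absurd ?_ (hM.2 (C.map D.subtype) (C'.map D.subtype) ?_ ?_)
  · rw [← Submodule.map_inf _ D.subtype_injective, hC'.inf_eq_bot, Submodule.map_bot]
  · rwa [Ne, ← Submodule.map_bot D.subtype,
      (Submodule.map_injective_of_injective D.subtype_injective).eq_iff]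
  · rwa [Ne, ← Submodule.map_bot D.subtype,
      (Submodule.map_injective_of_injective D.subtype_injective).eq_iff]

/-- If all submodules of `M` are automorphism-invariant, the image of a linear map between
independent submodules of `M` is contained in every essential submodule of the codomain. -/
theorem range_le_of_essential_of_disjoint {S M : Type*} [Ring S] [AddCommGroup M] [Module S M]
    (hM : ∀ I : Submodule S M, IsAutomorphismInvariant S I)
    {A B : Submodule S M} (hAB : Disjoint A B) (φ : A →ₗ[S] B) {E : Submodule S B}
    (hE : ∀ K : Submodule S B, Disjoint K E → K = ⊥) : LinearMap.range φ ≤ E := by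
  let ι : A × E →ₗ[S] M := A.subtype.coprod (B.subtype ∘ₗ E.subtype)
  have hι : Function.Injective ι := by
    refine (injective_iff_map_eq_zero ι).mpr ?_
    rintro ⟨a, e⟩ h
    have hae : (a : M) + ((e : B) : M) = 0 := h
    have ha : (a : M) = 0 := Submodule.disjoint_def.mp hAB _ a.2
      (eq_neg_of_add_eq_zero_left hae ▸ B.neg_mem (e : B).2)
    have he : ((e : B) : M) = 0 := by simpa [ha] using hae
    exact Prod.ext (Subtype.ext ha) (Subtype.ext (Subtype.ext he))
  exact ((hM (LinearMap.range ι)).of_equiv (LinearEquiv.ofInjective ι hι)).range_le_of_essential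
    hE φ

/-- If all submodules of `M` are automorphism-invariant, the image of a linear map between
independent submodules of `M` is semisimple. -/
theorem isSemisimpleModule_range_of_disjoint {S M : Type*} [Ring S] [AddCommGroup M] [Module S M]
    (hM : ∀ I : Submodule S M, IsAutomorphismInvariant S I)
    {A B : Submodule S M} (hAB : Disjoint A B) (φ : A →ₗ[S] B) :
    IsSemisimpleModule S (LinearMap.range φ) := by
  rw [isSemisimpleModule_iff]
  refine ⟨fun C => ?_⟩
  let D := LinearMap.range φ
  obtain ⟨C', hdisj, hess⟩ := Submodule.exists_disjoint_essential_sup (C.map D.subtype)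
  have hle : D ≤ C.map D.subtype ⊔ C' := range_le_of_essential_of_disjoint hM hAB φ hess
  refine ⟨C'.comap D.subtype, ?_, ?_⟩
  · rw [Submodule.disjoint_def]
    intro x hx hx'
    exact Subtype.ext (Submodule.disjoint_def.mp hdisj _ (Submodule.mem_map_of_mem hx) hx')
  · rw [codisjoint_iff_le_sup]
    intro x _
    obtain ⟨_, ⟨y, hy, rfl⟩, z, hz, hyz⟩ := Submodule.mem_sup.mp (hle x.2)
    refine Submodule.mem_sup.mpr ⟨y, hy, x - y, ?_, add_sub_cancel y x⟩
    have : D.subtype (x - y) = z := sub_eq_of_eq_add' hyz.symm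
    rwa [Submodule.mem_comap, this]

/-- a nonzero homomorphism between independent right ideals of a right
`a`-ring has semisimple image contained in the socle, which is simple when the
codomain is uniform. -/
theorem rightARing_hom_image_in_socle (R : Type*) [Ring R] (hR : IsRightARing R)
    (A B : Submodule Rᵐᵒᵖ R) (hAB : A ⊓ B = ⊥)
    (φ : (A : Type _) →ₗ[Rᵐᵒᵖ] B) (hφ : φ ≠ 0) :
    LinearMap.range φ ≤ moduleSocle Rᵐᵒᵖ B ∧
      IsSemisimpleModule Rᵐᵒᵖ (LinearMap.range φ) ∧
      (IsUniformModule Rᵐᵒᵖ B → IsSimpleModule Rᵐᵒᵖ (LinearMap.range φ)) := by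
  have hss := isSemisimpleModule_range_of_disjoint hR (disjoint_iff.mpr hAB) φ
  exact ⟨Submodule.le_moduleSocle_of_isSemisimpleModule _, hss, fun hB =>
    hB.isSimpleModule_of_isSemisimpleModule (mt LinearMap.range_eq_bot.mp hφ)⟩
end

section
/- Let R be a right a-ring and let e be a nontrivial idempotent of R (e ≠ 0, e ≠ 1) such that eR(1-e) ≠ 0. Then the socle of the right R-module eR is nonzero. -/
/-- Every submodule `K` admits a submodule `L` disjoint from it such that `K ⊔ L` is
essential. -/
theorem Submodule.exists_disjoint_sup_essential {A M : Type*} [Ring A] [AddCommGroup M]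
    [Module A M] (K : Submodule A M) :
    ∃ L : Submodule A M, Disjoint K L ∧ ∀ J : Submodule A M, (K ⊔ L) ⊓ J = ⊥ → J = ⊥ := by
  obtain ⟨L, -, hL⟩ := zorn_le_nonempty₀ {L : Submodule A M | Disjoint K L}
    (fun c hc hchain y hy =>
      ⟨sSup c, hchain.directedOn.disjoint_sSup_right.2 fun _ hb => hc hb, fun _ => le_sSup⟩)
    ⊥ disjoint_bot_right
  refine ⟨L, hL.prop, fun J hJ => ?_⟩
  have hd : Disjoint K (L ⊔ J) :=
    Disjoint.disjoint_sup_right_of_disjoint_sup_left hL.prop (disjoint_iff.2 hJ)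
  have hJL : J ≤ L := le_sup_right.trans (hL.le_of_ge hd le_sup_left)
  rw [← hJ, inf_eq_right.2 (hJL.trans le_sup_right)]

/-- The intersection of all essential submodules is contained in the socle; in particular a
nonzero element of this intersection forces the socle to be nonzero. -/
theorem moduleSocle_ne_bot_of_mem_essential {A M : Type*} [Ring A] [AddCommGroup M]
    [Module A M] {a : M} (ha : a ≠ 0)
    (h : ∀ K : Submodule A M, (∀ J : Submodule A M, K ⊓ J = ⊥ → J = ⊥) → a ∈ K) :
    moduleSocle A M ≠ ⊥ := by
  set S := Submodule.span A {a}
  have hS : ComplementedLattice (Set.Iic S) := by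
    refine ⟨fun ⟨K, hK⟩ => ?_⟩
    obtain ⟨L, hd, hess⟩ := K.exists_disjoint_sup_essential
    have hle : S ≤ K ⊔ L := by
      rw [Submodule.span_singleton_le_iff_mem]
      exact h _ hess
    refine ⟨⟨L ⊓ S, Set.mem_Iic.2 inf_le_right⟩, ?_⟩
    rw [Set.Iic.isCompl_iff]
    refine ⟨hd.mono_right inf_le_left, ?_⟩
    rw [← sup_inf_assoc_of_le L hK]
    exact inf_eq_right.2 hle
  have : IsSemisimpleModule A S := by
    rw [isSemisimpleModule_iff]
    exact S.mapIic.complementedLattice_iff.2 hS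
  have : Nontrivial S := Submodule.nontrivial_span_singleton ha
  obtain ⟨N, hN⟩ := IsSemisimpleModule.exists_simple_submodule A S
  have hN' : IsSimpleModule A (N.map S.subtype) :=
    IsSimpleModule.congr (Submodule.equivMapOfInjective _ S.subtype_injective N).symm
  intro hbot
  exact (Submodule.nontrivial_iff_ne_bot.1 (IsSimpleModule.nontrivial A (N.map S.subtype)))
    (le_bot_iff.1 (hbot ▸ le_sSup hN'))

/-- An essential right ideal of a right `a`-ring is stable under left multiplication by every
left-cancellable element. -/
theorem IsRightARing.mul_mem_of_essential {R : Type*} [Ring R] (hR : IsRightARing R)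
    {I : Submodule Rᵐᵒᵖ R} (hI : IsEssentialRightIdeal R I) {u : R}
    (hu : ∀ x, u * x = 0 → x = 0) {m : R} (hm : m ∈ I) : u * m ∈ I := by
  let N : Submodule Rᵐᵒᵖ I :=
    { carrier := {x | u * (x : R) ∈ I}
      zero_mem' := by simp
      add_mem' := fun {x y} hx hy => by
        simpa [mul_add] using I.add_mem hx hy
      smul_mem' := fun c x hx => by
        simpa [MulOpposite.smul_eq_mul_unop, mul_assoc] using I.smul_mem c hx }
  let f : N →ₗ[Rᵐᵒᵖ] I :=
    { toFun := fun x => ⟨u * (x : R), x.2⟩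
      map_add' := fun x y => Subtype.ext (by simp [mul_add])
      map_smul' := fun c x => Subtype.ext (by simp [mul_assoc]) }
  have hf : Function.Injective f := by
    intro x y hxy
    refine Subtype.ext (Subtype.ext (sub_eq_zero.1 (hu _ ?_)))
    rw [mul_sub, sub_eq_zero]
    exact congrArg Subtype.val hxy
  obtain ⟨g, hg⟩ := hR I N f hf
  let d : I →ₗ[Rᵐᵒᵖ] R :=
    { toFun := fun x => u * (x : R) - (g x : R)
      map_add' := fun x y => by simp [mul_add]; abel
      map_smul' := fun c x => by simp [mul_assoc, sub_mul] }
  have hd : LinearMap.range d = ⊥ := by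
    refine hI _ ((Submodule.eq_bot_iff _).2 ?_)
    rintro _ ⟨hyI, x, rfl⟩
    have hx : x ∈ N := by
      change u * (x : R) ∈ I
      simpa [d] using I.add_mem hyI (g x).2
    have := congrArg Subtype.val (hg ⟨x, hx⟩)
    exact sub_eq_zero.2 this.symm
  have h0 : d ⟨m, hm⟩ = 0 := by
    rw [LinearMap.range_eq_bot.1 hd, LinearMap.zero_apply]
  rw [show u * m = (g ⟨m, hm⟩ : R) from sub_eq_zero.1 h0]
  exact (g ⟨m, hm⟩).2

/-- The preimage of an essential submodule under a linear map is essential. -/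
theorem Submodule.comap_essential {A M P : Type*} [Ring A] [AddCommGroup M] [Module A M]
    [AddCommGroup P] [Module A P] (p : M →ₗ[A] P) {K : Submodule A P}
    (hK : ∀ J : Submodule A P, K ⊓ J = ⊥ → J = ⊥) (J : Submodule A M)
    (hJ : K.comap p ⊓ J = ⊥) : J = ⊥ := by
  have hmap : J.map p = ⊥ := by
    refine hK _ ((Submodule.eq_bot_iff _).2 ?_)
    rintro _ ⟨hy, x, hx, rfl⟩
    have : x ∈ K.comap p ⊓ J := ⟨hy, hx⟩
    rw [hJ, Submodule.mem_bot] at this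
    rw [this, map_zero]
  have hle : J ≤ K.comap p := by
    rw [← Submodule.map_le_iff_le_comap, hmap]
    exact bot_le
  rw [← hJ, inf_eq_right.2 hle]

/-- if `e` is a nontrivial idempotent of a right `a`-ring with
`eR(1-e) ≠ 0`, then `Soc(eR) ≠ 0`. -/
theorem rightARing_socle_ne_bot (R : Type*) [Ring R] (hR : IsRightARing R)
    (e : R) (he : IsIdempotentElem e) (he0 : e ≠ 0) (he1 : e ≠ 1)
    (hne : ∃ r : R, e * r * (1 - e) ≠ 0) :
    moduleSocle Rᵐᵒᵖ (rightIdealOf R e) ≠ ⊥ := by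
  obtain ⟨r, hr⟩ := hne
  set a := e * r * (1 - e) with ha
  have hea : e * a = a := by rw [ha, ← mul_assoc, ← mul_assoc, he.eq]
  have hae : a * (1 - e) = a := by rw [ha, mul_assoc, he.one_sub.eq]
  have haa : a * a = 0 := by
    rw [← hea, mul_assoc, ← mul_assoc a e, ← hae, mul_assoc a, he.one_sub_mul_self]
    simp
  let p : R →ₗ[Rᵐᵒᵖ] rightIdealOf R e :=
    { toFun := fun x => ⟨e * x, x, rfl⟩
      map_add' := fun x y => Subtype.ext (by simp [mul_add])
      map_smul' := fun c x => Subtype.ext (by simp [mul_assoc]) }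
  refine moduleSocle_ne_bot_of_mem_essential (a := p a)
    (fun h => hr (hea ▸ congrArg Subtype.val h)) fun K hK => ?_
  have hmem : 1 - e ∈ K.comap p := by
    have : p (1 - e) = 0 := Subtype.ext he.mul_one_sub_self
    rw [Submodule.mem_comap, this]
    exact K.zero_mem
  have hu : ∀ x, (1 + a) * x = 0 → x = 0 := fun x hx => by
    have : (1 - a) * ((1 + a) * x) = x - a * a * x := by noncomm_ring
    rw [hx, haa] at this
    simpa using this.symm
  have := hR.mul_mem_of_essential (Submodule.comap_essential p hK) hu hmem
  rw [add_mul, one_mul, hae] at this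
  exact (Submodule.add_mem_iff_right (K.comap p) hmem).1 this
end

section
/- A right a-ring R is von Neumann regular if and only if R is semiprime. -/
section

variable {R : Type*} [Ring R]

theorem IsVonNeumannRegularRing.isSemiprimeRing (h : IsVonNeumannRegularRing R) :
    IsSemiprimeRing R := by
  rintro I ⟨n, -, hn⟩
  refine eq_bot_iff.2 fun a ha => ?_
  obtain ⟨b, hb⟩ := h a
  have hpow : ∀ k : ℕ, (a * b) ^ k * a = a := by
    intro k
    induction k with
    | zero => simp
    | succ k ih => rw [pow_succ, mul_assoc, ← hb, ih]
  have hzero : (a * b) ^ n = 0 := by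
    have := hn (List.replicate n (a * b)) (by simp) fun x hx => by
      rw [List.eq_of_mem_replicate hx]
      exact I.mul_mem_right _ _ ha
    rwa [List.prod_replicate] at this
  have ha0 : a = 0 := by rw [← hpow n, hzero, zero_mul]
  rw [ha0]
  exact zero_mem _

theorem IsSemiprimeRing.eq_zero_of_forall_mul_mul_eq_zero (h : IsSemiprimeRing R) {x : R}
    (hx : ∀ r, x * r * x = 0) : x = 0 := by
  have hleft : ∀ y ∈ TwoSidedIdeal.span {x}, ∀ r, y * r * x = 0 := by
    intro y hy
    let A : TwoSidedIdeal R := TwoSidedIdeal.mk' {y | ∀ r, y * r * x = 0}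
      (by simp) (by intro a b ha hb r; simp [add_mul, ha r, hb r])
      (by intro a ha r; simp [ha r]) (by intro a b hb r; simp [mul_assoc, hb r])
      (by intro a b ha r; rw [mul_assoc a]; exact ha _)
    have : y ∈ A := TwoSidedIdeal.mem_span_iff.1 hy A (by simpa [A] using hx)
    simpa [A] using this
  have hright : ∀ y' ∈ TwoSidedIdeal.span {x}, ∀ y ∈ TwoSidedIdeal.span {x},
      ∀ r, y * r * y' = 0 := by
    intro y' hy'
    let B : TwoSidedIdeal R :=
      TwoSidedIdeal.mk' {y' | ∀ y ∈ TwoSidedIdeal.span {x}, ∀ r, y * r * y' = 0}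
      (by simp) (by intro a b ha hb y hy r; simp [mul_add, ha y hy r, hb y hy r])
      (by intro a ha y hy r; simp [ha y hy r])
      (by intro a b hb y hy r; rw [← mul_assoc, mul_assoc y]; exact hb y hy _)
      (by intro a b ha y hy r; rw [← mul_assoc, ha y hy r, zero_mul])
    have : y' ∈ B := TwoSidedIdeal.mem_span_iff.1 hy' B (by simpa [B] using hleft)
    simpa [B] using this
  have hbot : TwoSidedIdeal.span {x} = ⊥ := h _ ⟨2, two_ne_zero, fun l hl hmem => by
    obtain ⟨a, b, rfl⟩ := List.length_eq_two.1 hl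
    simpa using hright b (hmem b (by simp)) a (hmem a (by simp)) 1⟩
  have hxmem : x ∈ TwoSidedIdeal.span {x} := TwoSidedIdeal.subset_span rfl
  rwa [hbot, TwoSidedIdeal.mem_bot] at hxmem

theorem IsRightARing.mul_mem_of_essential_s9 (hR : IsRightARing R) (E : Submodule Rᵐᵒᵖ R)
    (hE : ∀ x : R, x ≠ 0 → ∃ r, x * r ∈ E ∧ x * r ≠ 0) {u : R}
    (hu : ∀ x, u * x = 0 → x = 0) {x : R} (hx : x ∈ E) : u * x ∈ E := by
  let L : E →ₗ[Rᵐᵒᵖ] R := (LinearMap.mulLeft Rᵐᵒᵖ u).comp E.subtype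
  let f : E.comap L →ₗ[Rᵐᵒᵖ] E :=
    (L.comp (E.comap L).subtype).codRestrict E fun n => n.2
  have hf : Function.Injective f := by
    intro m n hmn
    have hval : u * m.1.1 = u * n.1.1 := congrArg Subtype.val hmn
    exact Subtype.ext (Subtype.ext (sub_eq_zero.1 (hu _ (by rw [mul_sub, hval, sub_self]))))
  obtain ⟨g, hg⟩ := hR E (E.comap L) f hf
  suffices h : (g ⟨x, hx⟩ : R) - u * x = 0 by
    rw [← sub_eq_zero.1 h]
    exact (g ⟨x, hx⟩).2
  by_contra hne
  obtain ⟨r, hr, hr0⟩ := hE _ hne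
  have hgr : ((g (MulOpposite.op r • ⟨x, hx⟩) : E) : R) = g ⟨x, hx⟩ * r := by
    rw [map_smul]; rfl
  have hmem : u * (x * r) ∈ E := by
    have := E.sub_mem (g (MulOpposite.op r • ⟨x, hx⟩)).2 hr
    rwa [hgr, sub_mul, sub_sub_cancel, mul_assoc] at this
  have hgu := congrArg Subtype.val (hg ⟨MulOpposite.op r • ⟨x, hx⟩, hmem⟩)
  apply hr0
  rw [sub_mul, ← hgr, mul_assoc, sub_eq_zero]
  exact hgu

theorem IsRightARing.eq_zero_of_singular (hR : IsRightARing R) (hS : IsSemiprimeRing R) {z : R}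
    (hz : ∀ x : R, x ≠ 0 → ∃ r, z * (x * r) = 0 ∧ x * r ≠ 0) : z = 0 := by
  have hstable : ∀ s t k, z * k = 0 → z * (s * z * t * k) = 0 := by
    intro s t k hk
    have h1 : (1 + s * z * t) * k ∈ rightAnnihilator R z := by
      refine hR.mul_mem_of_essential_s9 (rightAnnihilator R z) hz (fun x hx => ?_) hk
      by_contra hx0
      by_cases htx : t * x = 0
      · simp [add_mul, mul_assoc, htx, hx0] at hx
      · obtain ⟨r, hr, hr0⟩ := hz _ htx
        have h2 : (1 + s * z * t) * x * r = x * r + s * (z * (t * x * r)) := by noncomm_ring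
        rw [hx, hr, zero_mul, mul_zero, add_zero] at h2
        exact hr0 (by rw [mul_assoc, ← h2, mul_zero])
    have h3 : z * ((1 + s * z * t) * k) = 0 := h1
    simpa [add_mul, mul_add, hk] using h3
  by_contra hz0
  obtain ⟨r, hr, hr0⟩ := hz z hz0
  have hk : ∀ t t', z * r * t * (z * r) * t' * (z * r) = 0 := by
    intro t t'
    have := hstable (r * t) (r * t') (z * r) hr
    simpa only [mul_assoc] using this
  refine hr0 (hS.eq_zero_of_forall_mul_mul_eq_zero fun t => ?_)
  refine hS.eq_zero_of_forall_mul_mul_eq_zero fun s => ?_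
  have := hk t (s * (z * r) * t)
  simpa only [mul_assoc] using this

theorem IsRightARing.exists_mul_eq (hR : IsRightARing R) (N : Submodule Rᵐᵒᵖ R)
    (f : N →ₗ[Rᵐᵒᵖ] R) (hf : Function.Injective f) : ∃ b : R, ∀ n : N, b * n = f n := by
  let e := (Submodule.topEquiv : (⊤ : Submodule Rᵐᵒᵖ R) ≃ₗ[Rᵐᵒᵖ] R)
  let p : N.comap e.toLinearMap →ₗ[Rᵐᵒᵖ] N :=
    (e.toLinearMap.comp (N.comap e.toLinearMap).subtype).codRestrict N fun n => n.2
  have hp : Function.Injective p := fun a b h =>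
    Subtype.ext (e.injective (congrArg (Subtype.val : N → R) h))
  obtain ⟨g, hg⟩ := hR ⊤ (N.comap e.toLinearMap) (e.symm.toLinearMap.comp (f.comp p))
    (e.symm.injective.comp (hf.comp hp))
  refine ⟨e (g (e.symm 1)), fun n => ?_⟩
  have h1 : e.symm n = MulOpposite.op (n : R) • e.symm 1 := by
    rw [← map_smul]; simp
  have h2 : e (g (e.symm n)) = f n := congrArg e (hg ⟨e.symm n, n.2⟩)
  rwa [h1, map_smul, map_smul] at h2

theorem Submodule.exists_disjoint_essential_sup_s9 (K : Submodule Rᵐᵒᵖ R) :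
    ∃ C : Submodule Rᵐᵒᵖ R, Disjoint K C ∧
      ∀ x : R, x ≠ 0 → ∃ r, x * r ∈ K ⊔ C ∧ x * r ≠ 0 := by
  obtain ⟨C, hC⟩ := zorn_le₀ {C : Submodule Rᵐᵒᵖ R | Disjoint K C} fun c hc hchain =>
    ⟨sSup c, hchain.directedOn.disjoint_sSup_right.2 fun b hb => hc hb,
      fun _ => le_sSup⟩
  refine ⟨C, hC.prop, fun x hx => ?_⟩
  by_contra! hcon
  have hdisj : Disjoint K (C ⊔ Submodule.span Rᵐᵒᵖ {x}) := by
    rw [Submodule.disjoint_def]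
    intro y hyK hy
    obtain ⟨c, hc, w, hw, rfl⟩ := Submodule.mem_sup.1 hy
    obtain ⟨r, rfl⟩ := Submodule.mem_span_singleton.1 hw
    have hxr : x * r.unop = 0 := hcon _ <| by
      have := (K ⊔ C).sub_mem (Submodule.mem_sup_left hyK) (Submodule.mem_sup_right hc)
      rwa [add_sub_cancel_left] at this
    rw [MulOpposite.smul_eq_mul_unop, hxr, add_zero] at hyK ⊢
    exact Submodule.disjoint_def.1 hC.prop c hyK hc
  have hxC : x ∈ C := hC.le_of_ge hdisj le_sup_left
    (Submodule.mem_sup_right (Submodule.mem_span_singleton_self x))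
  exact hx (by simpa using hcon 1 (by simpa using Submodule.mem_sup_right hxC))

theorem IsRightARing.isVonNeumannRegularRing (hR : IsRightARing R) (hS : IsSemiprimeRing R) :
    IsVonNeumannRegularRing R := by
  intro a
  obtain ⟨C, hdisj, hess⟩ := (rightAnnihilator R a).exists_disjoint_essential_sup_s9
  let L : C →ₗ[Rᵐᵒᵖ] R := (LinearMap.mulLeft Rᵐᵒᵖ a).comp C.subtype
  have hL : Function.Injective L := (injective_iff_map_eq_zero L).2 fun c hc =>
    Subtype.ext (Submodule.disjoint_def.1 hdisj c hc c.2)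
  let e := LinearEquiv.ofInjective L hL
  obtain ⟨b, hb⟩ := hR.exists_mul_eq (LinearMap.range L) (C.subtype.comp e.symm.toLinearMap)
    (C.injective_subtype.comp e.symm.injective)
  have hbC : ∀ c ∈ C, b * (a * c) = c := by
    intro c hc
    have := hb (e ⟨c, hc⟩)
    simpa [e, L] using this
  refine ⟨b, sub_eq_zero.1 (hR.eq_zero_of_singular hS fun x hx => ?_)⟩
  obtain ⟨r, hr, hr0⟩ := hess x hx
  refine ⟨r, ?_, hr0⟩
  obtain ⟨k, hk, c, hc, hkc⟩ := Submodule.mem_sup.1 hr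
  have hk0 : a * k = 0 := hk
  rw [← hkc, sub_mul, mul_assoc, mul_assoc, mul_add a k c, hk0, zero_add, hbC c hc, sub_self]

end

/-- a right `a`-ring is von Neumann regular iff it is semiprime. -/
theorem rightARing_vonNeumannRegular_iff_semiprime (R : Type*) [Ring R]
    (hR : IsRightARing R) :
    IsVonNeumannRegularRing R ↔ IsSemiprimeRing R :=
  ⟨IsVonNeumannRegularRing.isSemiprimeRing, hR.isVonNeumannRegularRing⟩
end

section
/- Every right a-ring R is stably finite: for every positive integer n, the matrix ring M_n(R) is directly finite, i.e., for all x, y ∈ M_n(R), xy = 1 implies yx = 1. -/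
section Module

variable {A M : Type*} [Ring A] [AddCommGroup M] [Module A M]

/-- An injective map from `N ≤ I` into `I` extends to an endomorphism of `I`. -/
theorem exists_extension_of_injective (hM : ∀ I : Submodule A M, IsAutomorphismInvariant A I)
    {N I : Submodule A M} (hNI : N ≤ I) (f : N →ₗ[A] M) (hf : Function.Injective f)
    (hfI : ∀ n, f n ∈ I) :
    ∃ g : I →ₗ[A] I, ∀ n (hn : n ∈ N), (g ⟨n, hNI hn⟩ : M) = f ⟨n, hn⟩ := by
  let e := Submodule.comapSubtypeEquivOfLe hNI
  obtain ⟨g, hg⟩ := hM I (N.comap I.subtype) ((f.codRestrict I hfI) ∘ₗ e.toLinearMap) (by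
    intro x y hxy
    have h := congrArg Subtype.val hxy
    exact e.injective (hf h))
  refine ⟨g, fun n hn => ?_⟩
  have := congrArg Subtype.val (hg ⟨⟨n, hNI hn⟩, hn⟩)
  exact this

theorem exists_endomorphism_extension (hM : ∀ I : Submodule A M, IsAutomorphismInvariant A I)
    {N : Submodule A M} (f : N →ₗ[A] M) (hf : Function.Injective f) :
    ∃ g : Module.End A M, ∀ n (hn : n ∈ N), g n = f ⟨n, hn⟩ := by
  obtain ⟨g, hg⟩ := exists_extension_of_injective hM (le_top : N ≤ ⊤) f hf (by simp)
  exact ⟨(⊤ : Submodule A M).subtype ∘ₗ g ∘ₗ Submodule.topEquiv.symm.toLinearMap, hg⟩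

/-- Linear maps on two independent submodules glue to a linear map on their sum. -/
theorem Submodule.exists_glue_of_disjoint {P : Type*} [AddCommGroup P] [Module A P]
    {X Y : Submodule A M} (h : Disjoint X Y)
    (u : X →ₗ[A] P) (v : Y →ₗ[A] P) :
    ∃ F : ↥(X ⊔ Y) →ₗ[A] P, ∀ (x : X) (y : Y),
      F ⟨x + y, Submodule.add_mem_sup x.2 y.2⟩ = u x + v y := by
  have hag : ∀ (x : X) (y : Y), (x : M) = y → u x = v y := by
    intro x y hxy
    have hx : (x : M) = 0 := Submodule.disjoint_def.1 h _ x.2 (hxy ▸ y.2)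
    have hy : (y : M) = 0 := hxy ▸ hx
    rw [show x = 0 from Subtype.ext hx, show y = 0 from Subtype.ext hy, map_zero, map_zero]
  refine ⟨(LinearPMap.sup ⟨X, u⟩ ⟨Y, v⟩ hag).toFun, fun x y => ?_⟩
  exact LinearPMap.sup_apply (f := ⟨X, u⟩) (g := ⟨Y, v⟩) hag x y _ rfl

theorem Submodule.exists_injective_shear {X Y : Submodule A M} (h : Disjoint X Y)
    (f : X →ₗ[A] Y) :
    ∃ F : ↥(X ⊔ Y) →ₗ[A] M, Function.Injective F ∧ ∀ (x : X) (y : Y),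
      F ⟨x + y, Submodule.add_mem_sup x.2 y.2⟩ = x + (f x + y) := by
  obtain ⟨F, hF⟩ := Submodule.exists_glue_of_disjoint h (X.subtype + Y.subtype ∘ₗ f) Y.subtype
  have hF' : ∀ (x : X) (y : Y),
      F ⟨x + y, Submodule.add_mem_sup x.2 y.2⟩ = x + (f x + y) := fun x y => by
    rw [hF x y, ← add_assoc]
    rfl
  refine ⟨F, ?_, hF'⟩
  rw [injective_iff_map_eq_zero]
  rintro ⟨z, hz⟩ hz0
  obtain ⟨x, hx, y, hy, rfl⟩ := Submodule.mem_sup.1 hz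
  have h1 := hF' ⟨x, hx⟩ ⟨y, hy⟩
  rw [hz0] at h1
  have hx0 : x = 0 := by
    refine Submodule.disjoint_def.1 h x hx ?_
    rw [show x = _ from eq_neg_of_add_eq_zero_left h1.symm]
    exact Y.neg_mem (Y.add_mem (f ⟨x, hx⟩).2 hy)
  subst hx0
  have : f ⟨0, hx⟩ = 0 := map_zero f
  simp only [this, Submodule.coe_zero, zero_add] at h1
  simp [← h1]

/-- Independent submodules are relatively injective. -/
theorem exists_extension_of_disjoint (hM : ∀ I : Submodule A M, IsAutomorphismInvariant A I)
    {X Y C : Submodule A M} (h : Disjoint X Y) (hC : C ≤ X) (f : C →ₗ[A] Y) :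
    ∃ g : X →ₗ[A] Y, ∀ c (hc : c ∈ C), g ⟨c, hC hc⟩ = f ⟨c, hc⟩ := by
  obtain ⟨F, hF_inj, hF⟩ := Submodule.exists_injective_shear (h.mono_left hC) f
  obtain ⟨g, hg⟩ := exists_extension_of_injective hM (sup_le_sup_right hC Y) F hF_inj (by
    rintro ⟨z, hz⟩
    obtain ⟨c, hc, y, hy, rfl⟩ := Submodule.mem_sup.1 hz
    rw [hF ⟨c, hc⟩ ⟨y, hy⟩]
    exact Submodule.add_mem_sup (hC hc) (Y.add_mem (f ⟨c, hc⟩).2 hy))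
  obtain ⟨p, hp⟩ := Submodule.exists_glue_of_disjoint h (0 : X →ₗ[A] Y) LinearMap.id
  refine ⟨p ∘ₗ g ∘ₗ Submodule.inclusion le_sup_left, fun c hc => ?_⟩
  have h1 := hg c (Submodule.mem_sup_left hc)
  have h2 := hF ⟨c, hc⟩ 0
  simp only [Submodule.coe_zero, add_zero] at h2
  rw [h2] at h1
  have h3 := hp ⟨c, hC hc⟩ (f ⟨c, hc⟩)
  simp only [LinearMap.zero_apply, zero_add, LinearMap.id_apply] at h3
  rw [← h3]
  simp only [LinearMap.comp_apply]
  congr 1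
  exact Subtype.ext h1

/-- A submodule that has an independent isomorphic copy is semisimple. -/
theorem isSemisimpleModule_of_disjoint_linearEquiv
    (hM : ∀ I : Submodule A M, IsAutomorphismInvariant A I)
    {X Y : Submodule A M} (h : Disjoint X Y) (φ : X ≃ₗ[A] Y) : IsSemisimpleModule A X := by
  refine (isSemisimpleModule_iff A X).2 ⟨fun C => ?_⟩
  let C₁ : Submodule A M := C.map X.subtype
  let C₂ : Submodule A M := C.map (Y.subtype ∘ₗ φ.toLinearMap)
  have hC₁ : C₁ ≤ X := Submodule.map_subtype_le X C
  have hC₂ : C₂ ≤ Y := by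
    rintro _ ⟨c, -, rfl⟩
    exact (φ c).2
  let e₁ : C ≃ₗ[A] C₁ := C.equivMapOfInjective X.subtype X.injective_subtype
  let e₂ : C ≃ₗ[A] C₂ := C.equivMapOfInjective (Y.subtype ∘ₗ φ.toLinearMap)
    (Y.injective_subtype.comp φ.injective)
  obtain ⟨g, hg⟩ := exists_extension_of_disjoint hM (h.mono_right hC₂) hC₁
    (e₁.symm.trans e₂).toLinearMap
  refine ⟨LinearMap.ker (e₂.symm.toLinearMap ∘ₗ g),
    LinearMap.isCompl_of_proj (f := e₂.symm.toLinearMap ∘ₗ g) fun c => ?_⟩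
  have h1 := hg (c : X) (Submodule.mem_map_of_mem c.2)
  have h2 : (⟨((c : X) : M), Submodule.mem_map_of_mem c.2⟩ : C₁) = e₁ c := rfl
  simp only [LinearMap.comp_apply, LinearEquiv.coe_coe]
  rw [LinearEquiv.symm_apply_eq]
  rw [h2] at h1
  simpa using h1

theorem Submodule.exists_maximal_disjoint {X Y : Submodule A M} (h : Disjoint X Y) :
    ∃ Z, Y ≤ Z ∧ Maximal (fun Z => Disjoint X Z) Z := by
  refine zorn_le_nonempty₀ {Z | Disjoint X Z} (fun c hc hch y hy => ?_) Y h
  exact ⟨sSup c, hch.directedOn.disjoint_sSup_right.2 fun b hb => hc hb,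
    fun z hz => le_sSup hz⟩

/-- A submodule is essential if it meets every nonzero submodule nontrivially. -/
def Submodule.IsEssential (N : Submodule A M) : Prop :=
  ∀ J, Disjoint N J → J = ⊥

theorem Submodule.IsEssential.mono {N N' : Submodule A M} (h : N.IsEssential) (hN : N ≤ N') :
    N'.IsEssential := fun J hJ => h J (hJ.mono_left hN)

theorem Submodule.IsEssential.inf {N N' : Submodule A M} (h : N.IsEssential)
    (h' : N'.IsEssential) : (N ⊓ N').IsEssential := fun J hJ => by
  rw [disjoint_iff, inf_assoc] at hJ
  have := h _ (disjoint_iff.2 hJ)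
  exact h' _ (disjoint_iff.2 this)

theorem Submodule.IsEssential.comap {N : Submodule A M} (h : N.IsEssential)
    (f : Module.End A M) : (N.comap f).IsEssential := fun J hJ => by
  have h1 : J.map f = ⊥ := by
    refine h _ (Submodule.disjoint_def.2 ?_)
    rintro _ hx ⟨j, hj, rfl⟩
    rw [Submodule.disjoint_def.1 hJ j hx hj, map_zero]
  refine hJ.eq_bot_of_ge fun j hj => ?_
  have : f j ∈ J.map f := Submodule.mem_map_of_mem hj
  rw [h1, Submodule.mem_bot] at this
  simp [this]

theorem Submodule.isEssential_sup_of_maximal_disjoint {X Y : Submodule A M}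
    (h : Maximal (fun Z => Disjoint X Z) Y) : (X ⊔ Y).IsEssential := fun J hJ => by
  have h1 : Disjoint X (Y ⊔ J) := h.prop.disjoint_sup_right_of_disjoint_sup_left hJ
  have h2 : J ≤ Y := le_sup_right.trans (h.le_of_ge h1 le_sup_left)
  exact (hJ.mono_left le_sup_right).eq_bot_of_ge h2

theorem exists_shear (hM : ∀ I : Submodule A M, IsAutomorphismInvariant A I)
    {X Y : Submodule A M} (h : Disjoint X Y) (f : X →ₗ[A] Y) :
    ∃ g : Module.End A M, (∀ x (hx : x ∈ X), g x = f ⟨x, hx⟩) ∧ ∀ y ∈ Y, g y = 0 := by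
  obtain ⟨F, hF_inj, hF⟩ := Submodule.exists_injective_shear h f
  obtain ⟨g, hg⟩ := exists_endomorphism_extension hM F hF_inj
  refine ⟨g - 1, fun x hx => ?_, fun y hy => ?_⟩
  · have h1 := hg x (Submodule.mem_sup_left hx)
    have h2 := hF ⟨x, hx⟩ 0
    simp only [Submodule.coe_zero, add_zero] at h2
    simp [h1, h2]
  · have h1 := hg y (Submodule.mem_sup_right hy)
    have h2 := hF 0 ⟨y, hy⟩
    simp only [Submodule.coe_zero, zero_add, map_zero] at h2
    simp [h1, h2]

/-- A submodule `X` with an independent isomorphic copy is a direct summand, and the projection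
can be chosen to vanish on a prescribed maximal complement containing the copy. -/
theorem exists_projection (hM : ∀ I : Submodule A M, IsAutomorphismInvariant A I)
    {X B Y : Submodule A M} (hY : Maximal (fun Z => Disjoint X Z) Y) (hB : B ≤ Y)
    (φ : X ≃ₗ[A] B) :
    ∃ p : Module.End A M, LinearMap.range p = X ∧ (∀ x ∈ X, p x = x) ∧ ∀ y ∈ Y, p y = 0 := by
  obtain ⟨ψ, hψ⟩ := exists_extension_of_disjoint hM hY.prop.symm hB φ.symm.toLinearMap
  obtain ⟨v, hv, -⟩ := exists_shear hM hY.prop.symm ψ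
  obtain ⟨w, hw, hw'⟩ := exists_shear hM hY.prop (Submodule.inclusion hB ∘ₗ φ.toLinearMap)
  have hw₁ : ∀ x (hx : x ∈ X), w x = φ ⟨x, hx⟩ := hw
  have hp : ∀ x ∈ X, (v * w) x = x := by
    intro x hx
    rw [Module.End.mul_apply, hw₁ x hx, hv _ (hB (φ ⟨x, hx⟩).2), hψ _ (φ ⟨x, hx⟩).2]
    simp
  have hp' : ∀ y ∈ Y, (v * w) y = 0 := by
    intro y hy
    rw [Module.End.mul_apply, hw' y hy, map_zero]
  generalize v * w = p at hp hp'
  refine ⟨p, ?_, hp, hp'⟩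
  set Q := LinearMap.range p
  have hXQ : X ≤ Q := fun x hx => ⟨x, hp x hx⟩
  -- `X` is essential in the range of `p`.
  have hess : ∀ z ∈ Q, z ≠ 0 → ∃ c : A, c • z ∈ X ∧ c • z ≠ 0 := by
    rintro _ ⟨r, rfl⟩ hr
    have hrY : r ∉ Y := fun h => hr (hp' r h)
    have h1 : ¬ Disjoint X (Y ⊔ A ∙ r) := fun h => hrY <|
      hY.le_of_ge h le_sup_left (Submodule.mem_sup_right (Submodule.mem_span_singleton_self r))
    rw [Submodule.disjoint_def] at h1
    push Not at h1
    obtain ⟨x, hx, hx', hx0⟩ := h1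
    obtain ⟨y, hy, z, hz, rfl⟩ := Submodule.mem_sup.1 hx'
    obtain ⟨c, rfl⟩ := Submodule.mem_span_singleton.1 hz
    have h2 : c • p r = y + c • r := by
      have := hp _ hx
      rwa [map_add, hp' y hy, zero_add, map_smul] at this
    exact ⟨c, h2 ▸ hx, h2 ▸ hx0⟩
  have hw_zero : ∀ z ∈ Q, w z = 0 → z = 0 := by
    intro z hz hwz
    by_contra h0
    obtain ⟨c, hc, hc0⟩ := hess z hz h0
    have h1 := hw₁ _ hc
    rw [map_smul, hwz, smul_zero] at h1
    have h2 : φ ⟨_, hc⟩ = 0 := Subtype.ext h1.symm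
    rw [map_eq_zero_iff φ φ.injective] at h2
    exact hc0 (congrArg Subtype.val h2)
  have hdisj : Disjoint Q (LinearMap.range (w.domRestrict Q)) := by
    rw [Submodule.disjoint_def]
    rintro _ hz ⟨⟨x, hx⟩, rfl⟩
    rw [LinearMap.domRestrict_apply] at hz ⊢
    by_contra h0
    obtain ⟨c, hc, hc0⟩ := hess _ hz h0
    rw [← map_smul] at hc hc0
    have hcx0 : c • x ≠ 0 := fun h => hc0 (by rw [h, map_zero])
    obtain ⟨d, hd, hd0⟩ := hess (c • x) (Q.smul_mem c hx) hcx0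
    have h1 : w (d • c • x) ∈ B := by rw [hw₁ _ hd]; exact Subtype.prop _
    have h2 : w (d • c • x) ∈ X := by rw [map_smul]; exact X.smul_mem d hc
    have h3 := Submodule.disjoint_def.1 hY.prop _ h2 (hB h1)
    exact hd0 (hw_zero _ (Q.smul_mem d (Q.smul_mem c hx)) h3)
  have hinj : Function.Injective (w.domRestrict Q) := by
    rw [injective_iff_map_eq_zero]
    rintro ⟨z, hz⟩ h0
    exact Subtype.ext (hw_zero z hz h0)
  have hss := isSemisimpleModule_of_disjoint_linearEquiv hM hdisj (LinearEquiv.ofInjective _ hinj)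
  obtain ⟨C, hC⟩ := exists_isCompl (X.comap Q.subtype)
  have hC0 : C = ⊥ := by
    rw [Submodule.eq_bot_iff]
    intro z hz
    by_contra h0
    obtain ⟨c, hc, hc0⟩ := hess z z.2 (fun h => h0 (Subtype.ext h))
    exact hc0 (congrArg Subtype.val
      (Submodule.disjoint_def.1 hC.disjoint (c • z) hc (C.smul_mem c hz)))
  refine le_antisymm (fun z hz => ?_) hXQ
  have h1 := hC.sup_eq_top
  rw [hC0, sup_bot_eq] at h1
  have : (⟨z, hz⟩ : Q) ∈ X.comap Q.subtype := h1 ▸ Submodule.mem_top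
  exact this

/-- A submodule with an independent isomorphic copy is an image of the ambient module. -/
theorem exists_range_eq_of_disjoint_linearEquiv
    (hM : ∀ I : Submodule A M, IsAutomorphismInvariant A I)
    {X B : Submodule A M} (h : Disjoint X B) (φ : X ≃ₗ[A] B) :
    ∃ p : Module.End A M, LinearMap.range p = X := by
  obtain ⟨Y, hBY, hY⟩ := Submodule.exists_maximal_disjoint h
  obtain ⟨p, hp, -⟩ := exists_projection hM hY hBY φ
  exact ⟨p, hp⟩

/-- The isotypic components of simple submodules have finite length. -/
theorem finite_isotypicComponent [Module.Finite A M]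
    (hM : ∀ I : Submodule A M, IsAutomorphismInvariant A I)
    (S : Submodule A M) [IsSimpleModule A S] : Module.Finite A (isotypicComponent A M S) := by
  obtain ⟨ι, ⟨e⟩⟩ := (IsIsotypicOfType.isotypicComponent A M S).linearEquiv_finsupp
  rcases finite_or_infinite ι with hι | hι
  · exact Module.Finite.equiv e.symm
  exfalso
  have hnt := IsSimpleModule.nontrivial A S
  obtain ⟨d⟩ : Nonempty (ι ⊕ ι ≃ ι) := by
    rw [← Cardinal.eq]
    simp
  let k : (ι →₀ S) × (ι →₀ S) →ₗ[A] M := (isotypicComponent A M S).subtype ∘ₗ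
    ((Finsupp.sumFinsuppLEquivProdFinsupp A).symm.trans
      ((Finsupp.domLCongr d).trans e.symm)).toLinearMap
  have hk : Function.Injective k :=
    (Submodule.injective_subtype _).comp (LinearEquiv.injective _)
  have h₁ : Function.Injective (k ∘ₗ LinearMap.inl A _ _) := hk.comp LinearMap.inl_injective
  have h₂ : Function.Injective (k ∘ₗ LinearMap.inr A _ _) := hk.comp LinearMap.inr_injective
  have hdisj : Disjoint (LinearMap.range (k ∘ₗ LinearMap.inl A _ _))
      (LinearMap.range (k ∘ₗ LinearMap.inr A _ _)) := by
    rw [Submodule.disjoint_def]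
    rintro _ ⟨a, rfl⟩ ⟨b, hb⟩
    have := congrArg Prod.fst (hk hb)
    simp only [LinearMap.inr_apply, LinearMap.inl_apply] at this
    rw [← this, map_zero]
  obtain ⟨p, hp⟩ := exists_range_eq_of_disjoint_linearEquiv hM hdisj
    ((LinearEquiv.ofInjective _ h₁).symm.trans (LinearEquiv.ofInjective _ h₂))
  have hfin : Module.Finite A (LinearMap.range (k ∘ₗ LinearMap.inl A _ _)) := by
    rw [← hp]
    infer_instance
  have hfin' : Module.Finite A (ι →₀ S) := Module.Finite.equiv (LinearEquiv.ofInjective _ h₁).symm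
  rw [Module.finite_finsupp_iff] at hfin'
  rcases hfin' with h | h | h
  · exact not_isEmpty_of_nonempty ι h
  · exact not_subsingleton _ h
  · exact hι.not_finite h.2

/-- Endomorphisms are von Neumann regular modulo those with essential kernel. -/
theorem exists_isEssential_ker_sub_mul (hM : ∀ I : Submodule A M, IsAutomorphismInvariant A I)
    (a : Module.End A M) :
    ∃ b : Module.End A M, (LinearMap.ker (a - a * b * a)).IsEssential := by
  obtain ⟨K, -, hK⟩ := Submodule.exists_maximal_disjoint (disjoint_bot_right (a := LinearMap.ker a))
  have hinj : Function.Injective (a.domRestrict K) := by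
    rw [injective_iff_map_eq_zero]
    rintro ⟨z, hz⟩ h0
    exact Subtype.ext (Submodule.disjoint_def.1 hK.prop z h0 hz)
  let e := LinearEquiv.ofInjective _ hinj
  obtain ⟨b, hb⟩ := exists_endomorphism_extension hM (K.subtype ∘ₗ e.symm.toLinearMap)
    (K.injective_subtype.comp e.symm.injective)
  refine ⟨b, (Submodule.isEssential_sup_of_maximal_disjoint hK).mono (sup_le ?_ ?_)⟩
  · intro x hx
    rw [LinearMap.mem_ker] at hx
    simp [hx]
  · intro x hx
    have h1 := hb (a x) (LinearMap.mem_range_self (a.domRestrict K) ⟨x, hx⟩)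
    have h2 : (⟨a x, LinearMap.mem_range_self (a.domRestrict K) ⟨x, hx⟩⟩ :
      LinearMap.range (a.domRestrict K)) = e ⟨x, hx⟩ := rfl
    rw [h2] at h1
    simp only [LinearMap.comp_apply, LinearEquiv.coe_coe, LinearEquiv.symm_apply_apply,
      Submodule.subtype_apply] at h1
    simp [h1]

theorem exists_mul_one_sub_eq_one (hM : ∀ I : Submodule A M, IsAutomorphismInvariant A I)
    {a : Module.End A M} (ha : (LinearMap.ker a).IsEssential) :
    ∃ b : Module.End A M, b * (1 - a) = 1 := by
  have hinj : Function.Injective (1 - a : Module.End A M) := by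
    rw [← LinearMap.ker_eq_bot]
    refine ha _ (Submodule.disjoint_def.2 fun x hx hx' => ?_)
    rw [LinearMap.mem_ker] at hx hx'
    simpa [hx] using hx'
  let e := LinearEquiv.ofInjective _ hinj
  obtain ⟨b, hb⟩ := exists_endomorphism_extension hM e.symm.toLinearMap e.symm.injective
  refine ⟨b, LinearMap.ext fun x => ?_⟩
  have h1 := hb ((1 - a : Module.End A M) x) (LinearMap.mem_range_self _ x)
  rw [Module.End.mul_apply, h1]
  exact e.symm_apply_apply x

/-- If `a ^ 2` has essential kernel then, modulo endomorphisms with essential kernel, `a` factors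
through a projection onto a semisimple submodule. -/
theorem exists_semisimple_range (hM : ∀ I : Submodule A M, IsAutomorphismInvariant A I)
    {a : Module.End A M} (ha : (LinearMap.ker (a * a)).IsEssential) :
    ∃ p : Module.End A M, IsSemisimpleModule A (LinearMap.range p) ∧
      (LinearMap.ker (a - a * p)).IsEssential := by
  obtain ⟨K, -, hK⟩ := Submodule.exists_maximal_disjoint (disjoint_bot_right (a := LinearMap.ker a))
  set X := K ⊓ LinearMap.ker (a * a)
  have hXa : Disjoint X (LinearMap.ker a) := (hK.prop.symm).mono_left inf_le_left
  have hinj : Function.Injective (a.domRestrict X) := by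
    rw [injective_iff_map_eq_zero]
    rintro ⟨z, hz⟩ h0
    exact Subtype.ext (Submodule.disjoint_def.1 hXa z hz h0)
  have hB : LinearMap.range (a.domRestrict X) ≤ LinearMap.ker a := by
    rintro _ ⟨⟨x, hx⟩, rfl⟩
    exact hx.2
  let φ := LinearEquiv.ofInjective _ hinj
  have hss := isSemisimpleModule_of_disjoint_linearEquiv hM (hXa.mono_right hB) φ
  obtain ⟨Y, haY, hY⟩ := Submodule.exists_maximal_disjoint hXa
  obtain ⟨p, hp, hpX, hpY⟩ := exists_projection hM hY (hB.trans haY) φ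
  refine ⟨p, hp ▸ hss, ?_⟩
  refine ((Submodule.isEssential_sup_of_maximal_disjoint hK).inf ha).mono ?_
  have hle : LinearMap.ker a ≤ LinearMap.ker (a * a) := fun x hx => by
    rw [LinearMap.mem_ker] at hx
    simp [hx]
  rw [sup_inf_assoc_of_le K hle]
  refine sup_le (fun x hx => ?_) fun x hx => ?_
  · have := hpY x (haY hx)
    rw [LinearMap.mem_ker] at hx
    simp [hx, this]
  · simp [hpX x hx]

/-- The endomorphism ring of a Noetherian module is stably finite. -/
theorem isStablyFiniteRing_end_of_isNoetherian [IsNoetherian A M] :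
    IsStablyFiniteRing (Module.End A M) where
  isDedekindFiniteMonoid n := by
    refine ⟨fun {x y} hxy => ?_⟩
    let e : Module.End A (Fin n → M) ≃+* Matrix (Fin n) (Fin n) (Module.End A M) :=
      endVecRingEquivMatrixEnd (Fin n) A M
    apply e.symm.injective
    have h : e.symm x * e.symm y = 1 := by rw [← map_mul, hxy, map_one]
    rw [map_mul, map_one]
    have hsurj : Function.Surjective (e.symm x) := fun z => ⟨e.symm y z, LinearMap.congr_fun h z⟩
    have hinj := IsNoetherian.injective_of_surjective_endomorphism _ hsurj
    refine LinearMap.ext fun z => hinj ?_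
    exact LinearMap.congr_fun h (e.symm x z)

end Module

section Ring

variable {R : Type*} [Ring R]

/-- An element of `R` is right singular if its right annihilator is essential. -/
def IsRightSingular (a : R) : Prop :=
  (LinearMap.ker (RingEquiv.moduleEndSelfOp R a)).IsEssential

theorem IsRightSingular.mul_left {a : R} (ha : IsRightSingular a) (b : R) :
    IsRightSingular (b * a) := by
  refine Submodule.IsEssential.mono ha fun x hx => ?_
  rw [LinearMap.mem_ker] at hx ⊢
  rw [map_mul, Module.End.mul_apply, hx, map_zero]

theorem IsRightSingular.mul_right {a : R} (ha : IsRightSingular a) (b : R) :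
    IsRightSingular (a * b) := by
  refine (Submodule.IsEssential.comap ha (RingEquiv.moduleEndSelfOp R b)).mono fun x hx => ?_
  rw [Submodule.mem_comap, LinearMap.mem_ker] at hx
  rwa [LinearMap.mem_ker, map_mul, Module.End.mul_apply]

theorem IsRightARing.exists_isRightSingular_sub (hR : IsRightARing R) (a : R) :
    ∃ b : R, IsRightSingular (a - a * b * a) := by
  obtain ⟨b, hb⟩ := exists_isEssential_ker_sub_mul hR (RingEquiv.moduleEndSelfOp R a)
  refine ⟨(RingEquiv.moduleEndSelfOp R).symm b, ?_⟩
  rw [IsRightSingular, map_sub, map_mul, map_mul, RingEquiv.apply_symm_apply]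
  exact hb

theorem IsRightSingular.isUnit_one_sub (hR : IsRightARing R) {a : R} (ha : IsRightSingular a) :
    IsUnit (1 - a) := by
  have key : ∀ a : R, IsRightSingular a → ∃ b : R, b * (1 - a) = 1 := by
    intro a ha
    obtain ⟨b, hb⟩ := exists_mul_one_sub_eq_one hR ha
    refine ⟨(RingEquiv.moduleEndSelfOp R).symm b, (RingEquiv.moduleEndSelfOp R).injective ?_⟩
    rw [map_mul, map_sub, map_one, RingEquiv.apply_symm_apply, hb]
  obtain ⟨b, hb⟩ := key a ha
  have hb' : b = 1 - (-b) * a := by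
    rw [mul_sub, mul_one, sub_eq_iff_eq_add] at hb
    rw [neg_mul, sub_neg_eq_add, ← hb]
  obtain ⟨c, hc⟩ := key _ (ha.mul_left (-b))
  rw [← hb'] at hc
  have : c = 1 - a := left_inv_eq_right_inv hc hb
  rw [← this]
  exact isUnit_iff_exists.2 ⟨b, hc, this ▸ hb⟩

theorem Submodule.mul_mem_right {m : Submodule Rᵐᵒᵖ R} {x : R} (hx : x ∈ m) (r : R) :
    x * r ∈ m := m.smul_mem (MulOpposite.op r) hx

theorem IsCoatom.exists_mul_sub_mem {m : Submodule Rᵐᵒᵖ R} (hm : IsCoatom m) {r : R}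
    (hr : r ∉ m) (t : R) : ∃ q, r * q - t ∈ m := by
  have h : m ⊔ Rᵐᵒᵖ ∙ r = ⊤ := hm.2 _ (left_lt_sup.2 fun h =>
    hr (h (Submodule.mem_span_singleton_self r)))
  obtain ⟨y, hy, z, hz, hyz⟩ := Submodule.mem_sup.1 (h ▸ Submodule.mem_top : t ∈ m ⊔ Rᵐᵒᵖ ∙ r)
  obtain ⟨q, rfl⟩ := Submodule.mem_span_singleton.1 hz
  refine ⟨q.unop, ?_⟩
  have : r * q.unop - t = -y := by
    rw [← hyz, MulOpposite.smul_eq_mul_unop]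
    abel
  rw [this]
  exact m.neg_mem hy

theorem IsRightSingular.mem_of_isCoatom (hR : IsRightARing R) {a : R} (ha : IsRightSingular a)
    {m : Submodule Rᵐᵒᵖ R} (hm : IsCoatom m) : a ∈ m := by
  by_contra h
  obtain ⟨q, hq⟩ := hm.exists_mul_sub_mem h 1
  obtain ⟨u, hu⟩ := (ha.mul_right q).isUnit_one_sub hR
  have h1 : (1 : R) ∈ m := by
    have h2 := Submodule.mul_mem_right (m.neg_mem hq) (↑u⁻¹ : R)
    rwa [neg_sub, ← hu, Units.mul_inv] at h2
  exact hm.1 (Submodule.eq_top_iff'.2 fun x => by simpa using Submodule.mul_mem_right h1 x)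

theorem finite_mulOpposite_self : Module.Finite Rᵐᵒᵖ R :=
  ⟨⟨{1}, Submodule.eq_top_iff'.2 fun x => by
    rw [Finset.coe_singleton]
    exact Submodule.mem_span_singleton.2 ⟨MulOpposite.op x, by simp⟩⟩⟩

/-- If some element that is nilpotent modulo singular elements acts nontrivially on `R ⧸ m`, then
some two-sided ideal that is Noetherian on the right also acts nontrivially on `R ⧸ m`. -/
theorem IsRightARing.exists_isNoetherian_of_notMem (hR : IsRightARing R)
    {m : Submodule Rᵐᵒᵖ R} (hm : IsCoatom m) {a : R} (ha : IsRightSingular (a * a)) {r : R}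
    (hra : r * a ∉ m) :
    ∃ H : Submodule Rᵐᵒᵖ R, IsNoetherian Rᵐᵒᵖ H ∧ (∀ s, ∀ h ∈ H, s * h ∈ H) ∧
      ∃ t, ∃ h ∈ H, t * h ∉ m := by
  rw [IsRightSingular, map_mul] at ha
  obtain ⟨p, hp, hap⟩ := exists_semisimple_range hR ha
  obtain ⟨f, rfl⟩ := (RingEquiv.moduleEndSelfOp R).surjective p
  set K := LinearMap.range (RingEquiv.moduleEndSelfOp R f)
  have hfK : f ∈ K := ⟨1, mul_one f⟩
  rw [← map_mul, ← map_sub] at hap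
  have hf : (r * a) * f ∉ m := by
    intro h
    have h1 := IsRightSingular.mem_of_isCoatom hR (IsRightSingular.mul_left hap r) hm
    refine hra ?_
    convert m.add_mem h1 h using 1
    noncomm_ring
  let g : K →ₗ[Rᵐᵒᵖ] R ⧸ m := m.mkQ ∘ₗ RingEquiv.moduleEndSelfOp R (r * a) ∘ₗ K.subtype
  have hg : ∀ x : K, g x = 0 ↔ r * a * x ∈ m := fun x => m.mkQ_apply _ ▸
    Submodule.Quotient.mk_eq_zero m
  have hsimple : IsSimpleModule Rᵐᵒᵖ (R ⧸ m) := isSimpleModule_iff_isCoatom.2 hm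
  have hg0 : g ≠ 0 := fun h => hf ((hg ⟨f, hfK⟩).1 (by rw [h]; rfl))
  have hsurj := LinearMap.surjective_of_ne_zero hg0
  obtain ⟨N, hN⟩ := exists_isCompl (LinearMap.ker g)
  have e : (K ⧸ LinearMap.ker g) ≃ₗ[Rᵐᵒᵖ] N := Submodule.quotientEquivOfIsCompl _ _ hN
  have e' := (e.symm.trans (g.quotKerEquivOfSurjective hsurj))
  have hNs : IsSimpleModule Rᵐᵒᵖ N := IsSimpleModule.congr e'
  have eN : N ≃ₗ[Rᵐᵒᵖ] N.map K.subtype := N.equivMapOfInjective _ K.injective_subtype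
  have hNs' : IsSimpleModule Rᵐᵒᵖ (N.map K.subtype) := eN.isSimpleModule_iff.1 hNs
  have := finite_mulOpposite_self (R := R)
  have hfin := finite_isotypicComponent hR (N.map K.subtype)
  refine ⟨isotypicComponent Rᵐᵒᵖ R (N.map K.subtype), inferInstance, fun s h hh =>
    LinearMap.le_comap_isotypicComponent (N.map K.subtype) (RingEquiv.moduleEndSelfOp R s) hh,
    r * a, ?_⟩
  by_contra! hcon
  have hN0 : N ≤ LinearMap.ker g := fun x hx => (hg x).2
    (hcon _ (Submodule.le_isotypicComponent _ (Submodule.mem_map_of_mem hx)))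
  have := IsSimpleModule.nontrivial Rᵐᵒᵖ N
  exact (Submodule.nontrivial_iff_ne_bot.1 this) (hN.disjoint.eq_bot_of_ge hN0)

/-- If all elements that are nilpotent modulo singular elements act trivially on `R ⧸ m`, then
`m` is a two-sided ideal. -/
theorem IsRightARing.mul_mem_left_of_forall (hR : IsRightARing R)
    {m : Submodule Rᵐᵒᵖ R} (hm : IsCoatom m)
    (h : ∀ a : R, IsRightSingular (a * a) → ∀ r, r * a ∈ m) {r : R} (hr : r ∈ m) (s : R) :
    s * r ∈ m := by
  by_contra hsr
  have h1 : (1 : R) ∉ m := fun h1 =>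
    hm.1 (Submodule.eq_top_iff'.2 fun x => by simpa using Submodule.mul_mem_right h1 x)
  obtain ⟨b, hb⟩ := hR.exists_isRightSingular_sub r
  have hse : s * (r * b) ∉ m := by
    intro hse
    have h2 := (hb.mul_left s).mem_of_isCoatom hR hm
    refine hsr ?_
    convert m.add_mem h2 (Submodule.mul_mem_right hse r) using 1
    noncomm_ring
  obtain ⟨c, hc⟩ := hm.exists_mul_sub_mem hse 1
  have hsing : IsRightSingular ((1 - r * b) * (r * b)) := by
    convert hb.mul_right b using 1
    noncomm_ring
  have hnil : IsRightSingular
      ((r * b * c * (1 - r * b)) * (r * b * c * (1 - r * b))) := by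
    convert (hsing.mul_left (r * b * c)).mul_right (c * (1 - r * b)) using 1
    simp only [mul_assoc]
  refine h1 ?_
  have h2 := m.sub_mem (h _ hnil s) (Submodule.mul_mem_right hc (1 - r * b))
  convert m.add_mem h2 (Submodule.mul_mem_right hr b) using 1
  noncomm_ring

theorem Matrix.map_one_sub_mul_eq_zero {S : Type*} [Ring S] [IsStablyFiniteRing S] (ρ : R →+* S)
    {n : ℕ} {x y : Matrix (Fin n) (Fin n) R} (hxy : x * y = 1) (i j : Fin n) :
    ρ ((1 - y * x) i j) = 0 := by
  have h : ρ.mapMatrix x * ρ.mapMatrix y = 1 := by rw [← map_mul, hxy, map_one]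
  have h2 : ρ.mapMatrix (1 - y * x) = 0 := by
    rw [map_sub, map_one, map_mul, mul_eq_one_comm.1 h, sub_self]
  exact congrFun (congrFun h2 i) j

theorem IsRightARing.mul_mem_of_isCoatom (hR : IsRightARing R)
    {m : Submodule Rᵐᵒᵖ R} (hm : IsCoatom m) {n : ℕ} {x y : Matrix (Fin n) (Fin n) R}
    (hxy : x * y = 1) (i j : Fin n) (s : R) : s * (1 - y * x) i j ∈ m := by
  by_cases h : ∀ a : R, IsRightSingular (a * a) → ∀ r, r * a ∈ m
  · have hleft := fun {r : R} (hr : r ∈ m) (s : R) => hR.mul_mem_left_of_forall hm h hr s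
    let P : Ideal R :=
      { carrier := m
        add_mem' := m.add_mem
        zero_mem' := m.zero_mem
        smul_mem' := fun s r hr => hleft hr s }
    have hP : P.IsTwoSided := ⟨fun b ha => Submodule.mul_mem_right (m := m) ha b⟩
    have h1 : (1 : R) ∉ m := fun h1 =>
      hm.1 (Submodule.eq_top_iff'.2 fun x => by simpa using Submodule.mul_mem_right h1 x)
    have hnt : Nontrivial (R ⧸ P) := Ideal.Quotient.nontrivial_iff.2 fun hP =>
      h1 ((Ideal.eq_top_iff_one P).1 hP)
    have hinv : ∀ z : R ⧸ P, z ≠ 0 → ∃ w, z * w = 1 := by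
      intro z hz
      obtain ⟨z, rfl⟩ := Ideal.Quotient.mk_surjective z
      obtain ⟨q, hq⟩ := hm.exists_mul_sub_mem
        (fun hzm => hz (Ideal.Quotient.eq_zero_iff_mem.2 hzm)) 1
      refine ⟨Ideal.Quotient.mk P q, ?_⟩
      rw [← map_mul, ← map_one (Ideal.Quotient.mk P)]
      exact Ideal.Quotient.eq.2 hq
    let : DivisionRing (R ⧸ P) := DivisionRing.ofIsUnitOrEqZero fun z => by
      by_cases hz : z = 0
      · exact Or.inr hz
      obtain ⟨w, hw⟩ := hinv z hz
      have hw0 : w ≠ 0 := by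
        rintro rfl
        simp at hw
      obtain ⟨v, hv⟩ := hinv w hw0
      have : z = v := left_inv_eq_right_inv hw hv
      exact Or.inl (isUnit_iff_exists.2 ⟨w, hw, this ▸ hv⟩)
    exact hleft (Ideal.Quotient.eq_zero_iff_mem.1
      (Matrix.map_one_sub_mul_eq_zero (Ideal.Quotient.mk P) hxy i j)) s
  · push Not at h
    obtain ⟨a, ha, r, hra⟩ := h
    obtain ⟨H, hH, hHl, t, k, hk, htk⟩ := hR.exists_isNoetherian_of_notMem hm ha hra
    let ρ : R →+* Module.End Rᵐᵒᵖ H :=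
      { toFun := fun r => (RingEquiv.moduleEndSelfOp R r).restrict (hHl r)
        map_one' := by ext; simp
        map_mul' := fun _ _ => by ext; simp [mul_assoc]
        map_zero' := by ext; simp
        map_add' := fun _ _ => by ext; simp [add_mul] }
    have hst : IsStablyFiniteRing (Module.End Rᵐᵒᵖ H) := isStablyFiniteRing_end_of_isNoetherian
    have hc : ∀ k ∈ H, (1 - y * x) i j * k = 0 := by
      intro k hk
      have h0 := Matrix.map_one_sub_mul_eq_zero (S := Module.End Rᵐᵒᵖ H) ρ hxy i j
      exact congrArg Subtype.val (LinearMap.congr_fun h0 ⟨k, hk⟩)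
    by_contra hs
    obtain ⟨q, hq⟩ := hm.exists_mul_sub_mem hs t
    have h2 := m.neg_mem (Submodule.mul_mem_right hq k)
    rw [sub_mul, mul_assoc, mul_assoc, hc _ (hHl q k hk), mul_zero, zero_sub, neg_neg] at h2
    exact htk h2

/-- An element all of whose left multiples lie in every maximal right ideal lies in the
Jacobson radical. -/
theorem mem_jacobson_bot_of_forall_isCoatom {c : R}
    (hc : ∀ m : Submodule Rᵐᵒᵖ R, IsCoatom m → ∀ s, s * c ∈ m) :
    c ∈ (⊥ : Ideal R).jacobson := by
  have key : ∀ d : R, (∀ m : Submodule Rᵐᵒᵖ R, IsCoatom m → d ∈ m) → ∃ b, (1 - d) * b = 1 := by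
    intro d hd
    have := finite_mulOpposite_self (R := R)
    have : IsCoatomic (Submodule Rᵐᵒᵖ R) := CompleteLattice.coatomic_of_top_compact
      ((Submodule.fg_iff_compact ⊤).1 Module.Finite.fg_top)
    have htop : rightIdealOf R (1 - d) = ⊤ := by
      rcases eq_top_or_exists_le_coatom (rightIdealOf R (1 - d)) with h | ⟨m, hm, hle⟩
      · exact h
      exfalso
      have h1 : (1 : R) ∈ m := by
        have := m.add_mem (hle ⟨1, (mul_one _).symm⟩ : 1 - d ∈ m) (hd m hm)
        rwa [sub_add_cancel] at this
      exact hm.1 (Submodule.eq_top_iff'.2 fun x => by simpa using Submodule.mul_mem_right h1 x)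
    obtain ⟨b, hb⟩ : (1 : R) ∈ rightIdealOf R (1 - d) := htop ▸ Submodule.mem_top
    exact ⟨b, hb.symm⟩
  rw [Ideal.mem_jacobson_iff]
  intro s
  obtain ⟨b, hb⟩ := key (-(s * c)) fun m hm => m.neg_mem (hc m hm s)
  have hb' : b = 1 - s * c * b := by
    rw [← hb]
    noncomm_ring
  obtain ⟨v, hv⟩ := key (s * c * b) fun m hm => Submodule.mul_mem_right (hc m hm s) b
  rw [← hb'] at hv
  have hv' : 1 - -(s * c) = v := left_inv_eq_right_inv hb hv
  refine ⟨b, ?_⟩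
  have : b * s * c + b - 1 = b * (1 - -(s * c)) - 1 := by noncomm_ring
  rw [this, hv', hv, sub_self]
  exact Ideal.zero_mem _

end Ring

/-- every right `a`-ring is stably finite. -/
theorem rightARing_stablyFinite (R : Type*) [Ring R] (hR : IsRightARing R) :
    ∀ n : ℕ, 0 < n → ∀ x y : Matrix (Fin n) (Fin n) R, x * y = 1 → y * x = 1 := by
  intro n _ x y hxy
  have hmem : 1 - y * x ∈ (⊥ : Ideal (Matrix (Fin n) (Fin n) R)).jacobson := by
    rw [← Ideal.matrix_bot]
    exact Ideal.matrix_jacobson_le ⊥ fun i j =>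
      mem_jacobson_bot_of_forall_isCoatom fun m hm s => hR.mul_mem_of_isCoatom hm hxy i j s
  obtain ⟨z, hz⟩ := Ideal.mem_jacobson_iff.1 hmem (-1)
  rw [Ideal.mem_bot] at hz
  have hz' : z * (y * x) = 1 := by
    rw [← sub_eq_zero, ← hz]
    noncomm_ring
  have hid : y * x * (y * x) = y * x := by
    rw [mul_assoc, ← mul_assoc x, hxy, one_mul]
  calc y * x = z * (y * x) * (y * x) := by rw [hz', one_mul]
    _ = 1 := by rw [mul_assoc, hid, hz']
end

section
/- Every von Neumann regular right a-ring R is unit-regular: for every x ∈ R there exists a unit u ∈ R such that x = xux. -/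
open LinearMap in
theorem IsEssentialRightIdeal.comap_mulLeft {R : Type*} [Ring R] {K : Submodule Rᵐᵒᵖ R}
    (hK : IsEssentialRightIdeal R K) (a : R) :
    IsEssentialRightIdeal R (K.comap (mulLeft Rᵐᵒᵖ a)) := by
  intro J hJ
  have key : ∀ j ∈ J, a * j ∈ K → j = 0 := fun j hj hja ↦
    (Submodule.mem_bot Rᵐᵒᵖ).1 (hJ ▸ Submodule.mem_inf.2 ⟨hja, hj⟩)
  have hmap : J.map (mulLeft Rᵐᵒᵖ a) = ⊥ := by
    apply hK
    rw [eq_bot_iff]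
    rintro _ ⟨hk, j, hj, rfl⟩
    simp [key j hj hk]
  rw [eq_bot_iff]
  intro j hj
  have h0 : a * j = 0 := (Submodule.mem_bot Rᵐᵒᵖ).1 (hmap ▸ Submodule.mem_map_of_mem hj)
  exact (Submodule.mem_bot Rᵐᵒᵖ).2 (key j hj (h0 ▸ K.zero_mem))

theorem IsEssentialRightIdeal.inf {R : Type*} [Ring R] {K L : Submodule Rᵐᵒᵖ R}
    (hK : IsEssentialRightIdeal R K) (hL : IsEssentialRightIdeal R L) :
    IsEssentialRightIdeal R (K ⊓ L) := fun J hJ ↦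
  hL J (hK _ (by rwa [← inf_assoc]))

/-- Every right ideal disjoint from `A` is contained in a complement of `A` relative to an
essential right ideal. -/
theorem exists_disjoint_essential_sup {R : Type*} [Ring R] {A B : Submodule Rᵐᵒᵖ R}
    (h : Disjoint A B) :
    ∃ D, B ≤ D ∧ Disjoint A D ∧ IsEssentialRightIdeal R (A ⊔ D) := by
  obtain ⟨D, hBD, hD⟩ := zorn_le_nonempty₀ {D : Submodule Rᵐᵒᵖ R | Disjoint A D}
    (fun c hc hchain D hD ↦ ⟨sSup c,
      (hchain.directedOn.disjoint_sSup_right).2 fun _ hb ↦ hc hb,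
      fun _ ↦ le_sSup⟩) B h
  refine ⟨D, hBD, hD.prop, fun J hJ ↦ ?_⟩
  have hdis : Disjoint A (D ⊔ J) :=
    Disjoint.disjoint_sup_right_of_disjoint_sup_left hD.prop (disjoint_iff.2 hJ)
  have hJD : J ≤ D := le_sup_right.trans (hD.le_of_ge hdis le_sup_left)
  rwa [inf_eq_right.2 (hJD.trans le_sup_right)] at hJ

/-- A regular ring is right nonsingular. -/
theorem IsVonNeumannRegularRing.eq_zero_of_essential {R : Type*} [Ring R]
    (hreg : IsVonNeumannRegularRing R) {K : Submodule Rᵐᵒᵖ R} (hK : IsEssentialRightIdeal R K)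
    {r : R} (h : ∀ k ∈ K, r * k = 0) : r = 0 := by
  obtain ⟨s, hs⟩ := hreg r
  have hbot : rightIdealOf R (s * r) = ⊥ := by
    apply hK
    rw [eq_bot_iff]
    rintro _ ⟨hk, q, rfl⟩
    have hq : r * q = 0 := by
      have := h _ hk
      rwa [← mul_assoc, ← mul_assoc, ← hs] at this
    simp [mul_assoc, hq]
  have hsr : s * r ∈ rightIdealOf R (s * r) := ⟨1, by simp⟩
  rw [hbot, Submodule.mem_bot] at hsr
  rw [hs, mul_assoc, hsr, mul_zero]

open LinearMap in
theorem IsRightARing.mul_mem_of_essential_s11 {R : Type*} [Ring R] (hR : IsRightARing R)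
    (hreg : IsVonNeumannRegularRing R) {g : R} (hg : ∀ t, g * t = 0 → t = 0)
    {K : Submodule Rᵐᵒᵖ R} (hK : IsEssentialRightIdeal R K) {k : R} (hk : k ∈ K) :
    g * k ∈ K := by
  let N : Submodule Rᵐᵒᵖ K := (K.comap (mulLeft Rᵐᵒᵖ g)).comap K.subtype
  let f : N →ₗ[Rᵐᵒᵖ] K :=
    ((mulLeft Rᵐᵒᵖ g ∘ₗ K.subtype) ∘ₗ N.subtype).codRestrict K fun n ↦ n.2
  have hf : Function.Injective f := by
    rw [injective_iff_map_eq_zero]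
    intro n hn
    exact Subtype.ext (Subtype.ext (hg _ (congrArg Subtype.val hn)))
  obtain ⟨φ, hφ⟩ := hR K N f hf
  have hess : IsEssentialRightIdeal R (K ⊓ K.comap (mulLeft Rᵐᵒᵖ g)) :=
    hK.inf (hK.comap_mulLeft g)
  have h0 : (φ ⟨k, hk⟩ : R) - g * k = 0 := by
    refine hreg.eq_zero_of_essential (hess.comap_mulLeft k) fun t ht ↦ ?_
    obtain ⟨h1, h2⟩ := ht
    have h3 := congrArg Subtype.val (hφ ⟨⟨k * t, h1⟩, h2⟩)
    have h4 := congrArg Subtype.val (φ.map_smul (MulOpposite.op t) ⟨k, hk⟩)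
    have h5 : (φ ⟨k * t, h1⟩ : R) = φ ⟨k, hk⟩ * t := h4
    have h6 : (φ ⟨k * t, h1⟩ : R) = g * (k * t) := h3
    rw [sub_mul, ← h5, h6, mul_assoc, sub_self]
  rw [← sub_eq_zero.1 h0]
  exact (φ ⟨k, hk⟩).2

/-- The intersection of all essential right ideals, i.e. the right socle of `R`. -/
def essentialInf (R : Type*) [Ring R] : Submodule Rᵐᵒᵖ R :=
  sInf {K | IsEssentialRightIdeal R K}

theorem mem_essentialInf {R : Type*} [Ring R] {r : R} :
    r ∈ essentialInf R ↔ ∀ K, IsEssentialRightIdeal R K → r ∈ K :=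
  Submodule.mem_sInf

theorem IsRightARing.mem_essentialInf_of_mul_self {R : Type*} [Ring R] (hR : IsRightARing R)
    (hreg : IsVonNeumannRegularRing R) {r : R} (hr : r * r = 0) : r ∈ essentialInf R := by
  rw [mem_essentialInf]
  intro K hK
  obtain ⟨s, hs⟩ := hreg r
  have hg : ∀ t, (1 + r) * t = 0 → t = 0 := fun t ht ↦ by
    have : (1 - r) * ((1 + r) * t) = t - r * r * t := by noncomm_ring
    simpa [ht, hr] using this.symm
  have he : s * r ∈ K.comap (LinearMap.mulLeft Rᵐᵒᵖ (1 - s * r)) := by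
    have : (1 - s * r) * (s * r) = 0 := by
      rw [sub_mul, one_mul, mul_assoc, ← mul_assoc r, ← hs, sub_self]
    simp [this]
  have h := hR.mul_mem_of_essential_s11 hreg hg (hK.comap_mulLeft _) he
  have : (1 - s * r) * ((1 + r) * (s * r)) = r := by
    calc (1 - s * r) * ((1 + r) * (s * r))
        = s * r - s * (r * s * r) + r * s * r - s * (r * r) * (s * r) := by noncomm_ring
      _ = r := by simp [← hs, hr]
  simpa only [Submodule.mem_comap, LinearMap.mulLeft_apply, this] using h

theorem IsRightARing.mul_sub_mul_mem_essentialInf {R : Type*} [Ring R] (hR : IsRightARing R)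
    (hreg : IsVonNeumannRegularRing R) {e : R} (he : IsIdempotentElem e) (t : R) :
    e * t - t * e ∈ essentialInf R := by
  have he' : e * (1 - e) = 0 := by rw [mul_sub, mul_one, he.eq, sub_self]
  have he'' : (1 - e) * e = 0 := by rw [sub_mul, one_mul, he.eq, sub_self]
  have h1 : e * t * (1 - e) ∈ essentialInf R := by
    apply hR.mem_essentialInf_of_mul_self hreg
    calc _ = e * t * ((1 - e) * e) * t * (1 - e) := by noncomm_ring
      _ = 0 := by simp [he'']
  have h2 : (1 - e) * t * e ∈ essentialInf R := by
    apply hR.mem_essentialInf_of_mul_self hreg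
    calc _ = (1 - e) * t * (e * (1 - e)) * t * e := by noncomm_ring
      _ = 0 := by simp [he']
  convert sub_mem h1 h2 using 1
  noncomm_ring

/-- An injective map from a right ideal to `R` is left multiplication by an element of `R`. -/
theorem IsRightARing.exists_eq_mul_of_injective {R : Type*} [Ring R] (hR : IsRightARing R)
    {N : Submodule Rᵐᵒᵖ R} (f : N →ₗ[Rᵐᵒᵖ] R) (hf : Function.Injective f) :
    ∃ g : R, ∀ n : N, f n = g * n := by
  let I : Submodule Rᵐᵒᵖ R := ⊤
  let f' : N.comap I.subtype →ₗ[Rᵐᵒᵖ] I :=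
    (f ∘ₗ I.subtype.submoduleComap N).codRestrict I fun _ ↦ trivial
  have hf' : Function.Injective f' := fun a b hab ↦ by
    have h1 := hf (congrArg Subtype.val hab)
    exact Subtype.ext (Subtype.ext (congrArg (fun z : N ↦ (z : R)) h1))
  obtain ⟨φ, hφ⟩ := hR I _ f' hf'
  refine ⟨φ ⟨1, trivial⟩, fun n ↦ ?_⟩
  have h1 := congrArg Subtype.val (hφ ⟨⟨n, trivial⟩, n.2⟩)
  have h2 := congrArg Subtype.val (φ.map_smul (MulOpposite.op (n : R)) ⟨1, trivial⟩)
  have h3 : MulOpposite.op (n : R) • (⟨1, trivial⟩ : I) = ⟨n, trivial⟩ :=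
    Subtype.ext (one_mul _)
  rw [h3] at h2
  exact h1.symm.trans h2

open LinearMap in
/-- Left multiplication by `y` mapping `A` into a right ideal disjoint from `A` agrees on `A` with
left multiplication by an element of the socle. -/
theorem IsRightARing.exists_mem_essentialInf {R : Type*} [Ring R] (hR : IsRightARing R)
    (hreg : IsVonNeumannRegularRing R) {A B : Submodule Rᵐᵒᵖ R} (h : Disjoint A B) {y : R}
    (hy : ∀ a ∈ A, y * a ∈ B) : ∃ r ∈ essentialInf R, ∀ a ∈ A, r * a = y * a := by
  obtain ⟨D, hBD, hAD, hess⟩ := exists_disjoint_essential_sup h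
  have hzero : ∀ a ∈ A, ∀ d ∈ D, a + d = 0 → a = 0 ∧ d = 0 := fun a ha d hd h0 ↦ by
    have ha0 : a = 0 := Submodule.disjoint_def.1 hAD a ha
      (eq_neg_of_add_eq_zero_left h0 ▸ D.neg_mem hd)
    exact ⟨ha0, by simpa [ha0] using h0⟩
  let ψ : A × D →ₗ[Rᵐᵒᵖ] R := A.subtype.coprod D.subtype
  let χ : A × D →ₗ[Rᵐᵒᵖ] R := (A.subtype + mulLeft Rᵐᵒᵖ y ∘ₗ A.subtype).coprod D.subtype
  have hψ : Function.Injective ψ := by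
    rw [injective_iff_map_eq_zero]
    rintro ⟨a, d⟩ had
    obtain ⟨ha, hd⟩ := hzero a a.2 d d.2 had
    exact Prod.ext (Subtype.ext ha) (Subtype.ext hd)
  have hχ : Function.Injective χ := by
    rw [injective_iff_map_eq_zero]
    rintro ⟨a, d⟩ had
    have had' : (a : R) + (y * a + d) = 0 := by
      rw [← add_assoc]
      exact had
    obtain ⟨ha, hd⟩ := hzero a a.2 _ (D.add_mem (hBD (hy a a.2)) d.2) had'
    refine Prod.ext (Subtype.ext ha) (Subtype.ext ?_)
    simpa [ha] using hd
  let E := LinearEquiv.ofInjective ψ hψ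
  obtain ⟨g, hg⟩ := hR.exists_eq_mul_of_injective (χ ∘ₗ E.symm.toLinearMap)
    (hχ.comp E.symm.injective)
  have hg' : ∀ p, χ p = g * ψ p := fun p ↦ by
    have := hg (E p)
    rwa [comp_apply, LinearEquiv.coe_coe, E.symm_apply_apply] at this
  have hA : ∀ a ∈ A, (g - 1) * a = y * a := fun a ha ↦ by
    have h1 : a + y * a + 0 = g * (a + 0) := hg' (⟨a, ha⟩, 0)
    rw [add_zero, add_zero] at h1
    rw [sub_mul, ← h1, one_mul, add_sub_cancel_left]
  have hD : ∀ d ∈ D, (g - 1) * d = 0 := fun d hd ↦ by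
    have h1 : 0 + y * 0 + d = g * (0 + d) := hg' (0, ⟨d, hd⟩)
    rw [mul_zero, add_zero, zero_add] at h1
    rw [sub_mul, ← h1, one_mul, sub_self]
  refine ⟨g - 1, hR.mem_essentialInf_of_mul_self hreg
    (hreg.eq_zero_of_essential hess fun k hk ↦ ?_), hA⟩
  obtain ⟨a, ha, d, hd, rfl⟩ := Submodule.mem_sup.1 hk
  rw [mul_assoc, mul_add, hD d hd, add_zero, hA a ha, hD _ (hBD (hy a ha))]

theorem pow_mul_pow_mul_of_lt {R : Type*} [Ring R] {x y p : R} (hp : x * p = 0)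
    (h : ∀ n : ℕ, x ^ n * y ^ n * p = p) {k m : ℕ} (hkm : k < m) : x ^ m * (y ^ k * p) = 0 := by
  obtain ⟨d, rfl⟩ := Nat.exists_eq_add_of_lt hkm
  calc x ^ (k + d + 1) * (y ^ k * p) = x ^ (d + 1) * (x ^ k * y ^ k * p) := by
        rw [show k + d + 1 = d + 1 + k by omega, pow_add x (d + 1)]
        noncomm_ring
    _ = 0 := by rw [h, pow_succ, mul_assoc, hp, mul_zero]

theorem iSupIndep_rightIdealOf_pow {R : Type*} [Ring R] {x y p : R} (hp : x * p = 0)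
    (h : ∀ n : ℕ, x ^ n * y ^ n * p = p) :
    iSupIndep fun n : ℕ ↦ rightIdealOf R (y ^ n * p) := by
  apply iSupIndep_of_dfinsupp_lsum_injective
  refine (injective_iff_map_eq_zero _).2 fun v hv ↦ ?_
  classical
  by_contra hne
  have hsupp : v.support.Nonempty := by
    rwa [Finset.nonempty_iff_ne_empty, Ne, DFinsupp.support_eq_empty]
  let m := v.support.max' hsupp
  have hm : v m ≠ 0 := DFinsupp.mem_support_iff.1 (v.support.max'_mem hsupp)
  have hsum : ∑ i ∈ v.support, (v i : R) = 0 := by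
    simpa [DFinsupp.sumAddHom_apply, DFinsupp.sum] using hv
  have hxm : x ^ m * (v m : R) = 0 := by
    rw [← mul_zero (x ^ m), ← hsum, Finset.mul_sum]
    symm
    apply Finset.sum_eq_single m
    · intro i hi him
      obtain ⟨r, hr⟩ := (v i).2
      rw [hr, ← mul_assoc, pow_mul_pow_mul_of_lt hp h
        (lt_of_le_of_ne (v.support.le_max' i hi) him), zero_mul]
    · exact absurd (v.support.max'_mem hsupp)
  obtain ⟨r, hr⟩ := (v m).2
  apply hm
  rw [hr, ← mul_assoc, ← mul_assoc, h] at hxm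
  exact Subtype.ext (by rw [hr, mul_assoc, hxm, mul_zero]; rfl)

theorem IsRightARing.eq_zero_of_pow_mul_pow {R : Type*} [Ring R] (hR : IsRightARing R)
    (hreg : IsVonNeumannRegularRing R) {x y p : R} (hp : x * p = 0)
    (h : ∀ n : ℕ, x ^ n * y ^ n * p = p) : p = 0 := by
  let S : ℕ → Submodule Rᵐᵒᵖ R := fun n ↦ rightIdealOf R (y ^ n * p)
  let A := ⨆ n ∈ {n : ℕ | Even n}, S n
  let B := ⨆ n ∈ {n : ℕ | Odd n}, S n
  have hmemS : ∀ n, y ^ n * p ∈ S n := fun n ↦ ⟨1, (mul_one _).symm⟩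
  have hSA : ∀ n, Even n → S n ≤ A := fun n hn ↦ le_iSup₂_of_le n hn le_rfl
  have hSB : ∀ n, Odd n → S n ≤ B := fun n hn ↦ le_iSup₂_of_le n hn le_rfl
  have hAB : Disjoint A B := (iSupIndep_rightIdealOf_pow hp h).disjoint_biSup_biSup
    (Set.disjoint_left.2 fun n hn hn' ↦ Nat.not_even_iff_odd.2 hn' hn)
  have hy : A ≤ B.comap (LinearMap.mulLeft Rᵐᵒᵖ y) := iSup₂_le fun n hn ↦ by
    rintro _ ⟨r, rfl⟩
    exact hSB (n + 1) (Even.add_one hn)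
      ⟨r, by simp only [LinearMap.mulLeft_apply, pow_succ', mul_assoc]⟩
  obtain ⟨r, hr, hrA⟩ := hR.exists_mem_essentialInf hreg hAB hy
  obtain ⟨C, -, hBC, hess⟩ := exists_disjoint_essential_sup (disjoint_bot_right (a := B))
  obtain ⟨b, hb, c, hc, hbc⟩ := Submodule.mem_sup.1 (mem_essentialInf.1 hr _ hess)
  obtain ⟨m, hm⟩ : ∃ m, x ^ m * b = 0 := by
    refine Submodule.iSup_induction S (motive := fun b ↦ ∃ m, x ^ m * b = 0)
      (iSup₂_le (fun n _ ↦ le_iSup S n) hb) (fun n _ ⟨r, hr⟩ ↦ ⟨n + 1, ?_⟩) ⟨0, mul_zero _⟩ ?_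
    · rw [hr, ← mul_assoc, pow_mul_pow_mul_of_lt hp h n.lt_succ_self, zero_mul]
    · rintro s t ⟨i, hi⟩ ⟨j, hj⟩
      refine ⟨i + j, ?_⟩
      rw [mul_add, pow_add, mul_assoc, mul_assoc, hj, mul_zero, add_zero, ← mul_assoc, ← pow_add,
        add_comm, pow_add, mul_assoc, hi, mul_zero]
  let t := y ^ (2 * m) * p
  have ht : r * t = y * t := hrA t (hSA _ (even_two_mul m) (hmemS _))
  have hyt : y * t ∈ B := hy (hSA _ (even_two_mul m) (hmemS _))
  have hct : c * t = 0 := by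
    refine Submodule.disjoint_def.1 hBC _ ?_ (C.smul_mem (MulOpposite.op t) hc)
    rw [show c * t = y * t - b * t by rw [← ht, ← hbc, add_mul, add_sub_cancel_left]]
    exact B.sub_mem hyt (B.smul_mem (MulOpposite.op t) hb)
  have hbt : y ^ (2 * m + 1) * p = b * t := by
    rw [pow_succ', mul_assoc, ← ht, ← hbc, add_mul, hct, add_zero]
  rw [← h (2 * m + 1), mul_assoc, hbt, show 2 * m + 1 = m + 1 + m by omega, pow_add x (m + 1),
    mul_assoc, ← mul_assoc (x ^ m), hm, zero_mul, mul_zero]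

theorem isArtinian_rightIdealOf {R : Type*} [Ring R] {q : R} (hq : q ∈ essentialInf R) :
    IsArtinian Rᵐᵒᵖ (rightIdealOf R q) := by
  have hle : ∀ K, IsEssentialRightIdeal R K → rightIdealOf R q ≤ K := by
    rintro K hK _ ⟨r, rfl⟩
    exact K.smul_mem (MulOpposite.op r) (mem_essentialInf.1 hq K hK)
  have hss : IsSemisimpleModule Rᵐᵒᵖ (rightIdealOf R q) := by
    refine (isSemisimpleModule_iff ..).2 ⟨fun L ↦ ?_⟩
    obtain ⟨C, -, hLC, hess⟩ :=
      exists_disjoint_essential_sup (disjoint_bot_right (a := L.map (Submodule.subtype _)))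
    refine ⟨C.comap (Submodule.subtype _), Submodule.disjoint_def.2 fun z hz hzC ↦ ?_,
      codisjoint_iff_le_sup.2 fun z _ ↦ ?_⟩
    · exact Subtype.ext (Submodule.disjoint_def.1 hLC z (Submodule.mem_map_of_mem hz) hzC)
    · obtain ⟨_, ⟨l, hl, rfl⟩, c, hc, hlc⟩ := Submodule.mem_sup.1 (hle _ hess z.2)
      refine Submodule.mem_sup.2 ⟨l, hl, z - l, ?_, by abel⟩
      have : ((z - l : rightIdealOf R q) : R) = c := by
        rw [Submodule.coe_sub, ← hlc]
        exact add_sub_cancel_left _ _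
      exact (this ▸ hc : ((z - l : rightIdealOf R q) : R) ∈ C)
  have hspan : rightIdealOf R q = Submodule.span Rᵐᵒᵖ {q} := by
    ext z
    rw [Submodule.mem_span_singleton]
    exact ⟨fun ⟨r, hr⟩ ↦ ⟨MulOpposite.op r, hr.symm⟩, fun ⟨r, hr⟩ ↦ ⟨r.unop, hr.symm⟩⟩
  have hfin : Module.Finite Rᵐᵒᵖ (rightIdealOf R q) :=
    Module.Finite.iff_fg.2 (hspan ▸ Submodule.fg_span_singleton q)
  exact (IsSemisimpleModule.finite_tfae.out 0 2).1 hfin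

theorem exists_unit_of_add {R : Type*} [Ring R] {x y w : R} (hx : x = x * y * x)
    (h1 : x * y * w = 0) (h2 : w * (y * x) = 0)
    (h : ∃ u : Rˣ, x + w = (x + w) * u * (x + w)) : ∃ u : Rˣ, x = x * u * x := by
  obtain ⟨u, hu⟩ := h
  refine ⟨u, ?_⟩
  have e1 : x * y * (x + w) = x := by rw [mul_add, ← hx, h1, add_zero]
  have e2 : (x + w) * (y * x) = x := by rw [add_mul, h2, add_zero, ← mul_assoc, ← hx]
  calc x = x * y * (x + w) * (y * x) := by rw [e1, ← mul_assoc, ← hx]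
    _ = x * y * ((x + w) * u * (x + w)) * (y * x) := by rw [← hu]
    _ = (x * y * (x + w)) * u * ((x + w) * (y * x)) := by noncomm_ring
    _ = x * u * x := by rw [e1, e2]

theorem IsRightARing.unitRegular_of_annihilator_le {R : Type*} [Ring R] (hR : IsRightARing R)
    (hreg : IsVonNeumannRegularRing R) {Q : Submodule Rᵐᵒᵖ R} [IsArtinian Rᵐᵒᵖ Q] (x : R)
    (hx : rightAnnihilator R x ≤ Q) : ∃ u : Rˣ, x = x * u * x := by
  induction hN : (rightAnnihilator R x).comap Q.subtype using WellFoundedLT.induction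
    generalizing x with
  | ind N ih =>
    obtain ⟨y, hy⟩ := hreg x
    have hxf : x * (1 - y * x) = 0 := by rw [mul_sub, mul_one, ← mul_assoc, ← hy, sub_self]
    have hex : (1 - x * y) * x = 0 := by rw [sub_mul, one_mul, ← hy, sub_self]
    have hee : x * y * (1 - x * y) = 0 := by
      rw [mul_sub, mul_one, ← mul_assoc, ← hy, sub_self]
    have hff : (1 - y * x) * (y * x) = 0 := by
      rw [mul_assoc] at hy
      rw [sub_mul, one_mul, mul_assoc, ← hy, sub_self]
    by_cases hcase : ∀ t, (1 - x * y) * t * (1 - y * x) = 0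
    · have hpow : ∀ n : ℕ, x ^ n * y ^ n * (1 - y * x) = 1 - y * x := by
        intro n
        induction n with
        | zero => simp
        | succ n ihn =>
          have h1 : x * y * (y ^ n * (1 - y * x)) = y ^ n * (1 - y * x) := by
            have := hcase (y ^ n)
            rw [mul_assoc, sub_mul, one_mul, sub_eq_zero] at this
            exact this.symm
          calc x ^ (n + 1) * y ^ (n + 1) * (1 - y * x)
              = x ^ n * (x * y * (y ^ n * (1 - y * x))) := by
                rw [pow_succ, pow_succ']
                simp only [mul_assoc]
            _ = 1 - y * x := by rw [h1, ← mul_assoc, ihn]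
      have hyx : y * x = 1 := (sub_eq_zero.1 (hR.eq_zero_of_pow_mul_pow hreg hxf hpow)).symm
      have hye : y * (1 - x * y) = 0 := by
        rw [mul_sub, mul_one, ← mul_assoc, hyx, one_mul, sub_self]
      have hxy : x * y = 1 := (sub_eq_zero.1 (hR.eq_zero_of_pow_mul_pow hreg hye fun n ↦ by
        rw [pow_mul_pow_eq_one n hyx, one_mul])).symm
      exact ⟨⟨y, x, hyx, hxy⟩, hy⟩
    · obtain ⟨t, ht⟩ := not_forall.1 hcase
      have h1 : x * y * ((1 - x * y) * t * (1 - y * x)) = 0 := by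
        rw [mul_assoc (1 - x * y), ← mul_assoc, hee, zero_mul]
      have h2 : (1 - x * y) * t * (1 - y * x) * (y * x) = 0 := by rw [mul_assoc, hff, mul_zero]
      have h3 : (1 - x * y) * t * (1 - y * x) * (1 - y * x) = (1 - x * y) * t * (1 - y * x) := by
        rw [mul_sub _ 1 (y * x), mul_one, h2, sub_zero]
      set w := (1 - x * y) * t * (1 - y * x)
      have hann : rightAnnihilator R (x + w) ≤ rightAnnihilator R x := fun s hs ↦ by
        have hs' : (x + w) * s = 0 := hs
        have : x * y * ((x + w) * s) = x * s := by
          rw [← mul_assoc, mul_add, ← hy, h1, add_zero]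
        exact this.symm.trans (by rw [hs', mul_zero])
      refine exists_unit_of_add hy h1 h2 (ih _ ?_ (x + w) (hann.trans hx) rfl)
      rw [← hN]
      refine ⟨Submodule.comap_mono hann, fun hle ↦ ht ?_⟩
      have h4 : (x + w) * (1 - y * x) = 0 := @hle ⟨1 - y * x, hx hxf⟩ hxf
      rwa [add_mul, hxf, zero_add, h3] at h4

/-- every von Neumann regular right `a`-ring is unit-regular. -/
theorem rightARing_regular_is_unitRegular (R : Type*) [Ring R]
    (hR : IsRightARing R) (hreg : IsVonNeumannRegularRing R) :
    ∀ x : R, ∃ u : Rˣ, x = x * u * x := by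
  intro x
  obtain ⟨y, hy⟩ := hreg x
  have he : IsIdempotentElem (x * y) := by
    rw [IsIdempotentElem, ← mul_assoc, ← hy]
  have hf : IsIdempotentElem (y * x) := by
    rw [IsIdempotentElem, mul_assoc, ← mul_assoc x, ← hy]
  have hq : x * y - y * x ∈ essentialInf R := by
    have h1 := (essentialInf R).smul_mem (MulOpposite.op y)
      (hR.mul_sub_mul_mem_essentialInf hreg hf x)
    have h2 := (essentialInf R).smul_mem (MulOpposite.op x)
      (hR.mul_sub_mul_mem_essentialInf hreg he y)
    have h3 := hR.mul_sub_mul_mem_essentialInf hreg hf (x * y)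
    rw [op_smul_eq_mul] at h1 h2
    convert sub_mem (add_mem h2 h3) h1 using 1
    have h4 : y * (x * y) * x = y * x := by rw [← mul_assoc, mul_assoc (y * x), hf.eq]
    have h5 : x * (y * x) * y = x * y := by rw [← mul_assoc, mul_assoc (x * y), he.eq]
    rw [sub_mul, sub_mul, h4, h5]
    noncomm_ring
  have := isArtinian_rightIdealOf hq
  refine exists_unit_of_add (w := (1 - x * y) * (1 - y * x)) hy ?_ ?_
    (hR.unitRegular_of_annihilator_le hreg (Q := rightIdealOf R (x * y - y * x)) _ ?_)
  · rw [← mul_assoc, mul_sub (x * y), mul_one, he.eq, sub_self, zero_mul]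
  · rw [mul_assoc, sub_mul 1 (y * x), one_mul, hf.eq, sub_self, mul_zero]
  · intro t ht
    have ht' : (x + (1 - x * y) * (1 - y * x)) * t = 0 := ht
    have hxt : x * t = 0 := by
      have : x * y * ((x + (1 - x * y) * (1 - y * x)) * t) = x * t := by
        rw [← mul_assoc, mul_add, ← hy, ← mul_assoc (x * y), mul_sub (x * y), mul_one, he.eq,
          sub_self, zero_mul, add_zero]
      rw [← this, ht', mul_zero]
    have hyxt : y * x * t = 0 := by rw [mul_assoc, hxt, mul_zero]
    rw [add_mul, hxt, zero_add, mul_assoc, sub_mul 1 (y * x), hyxt, sub_zero, one_mul, sub_mul,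
      one_mul, sub_eq_zero] at ht'
    exact ⟨t, by rw [sub_mul, hyxt, sub_zero, ← ht']⟩
end

section
/- Let V be a vector space over a division ring D. The ring R = End(V_D) of all D-linear endomorphisms of V is a right a-ring if and only if V is finite-dimensional over D. -/
theorem IsSemisimpleModule.isAutomorphismInvariant (A : Type*) [Ring A] (M : Type*)
    [AddCommGroup M] [Module A M] [IsSemisimpleModule A M] : IsAutomorphismInvariant A M := by
  intro N f _
  obtain ⟨N', hN⟩ := exists_isCompl N
  exact ⟨f ∘ₗ N.projectionOnto N' hN, fun n => by simp⟩

section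

open Cardinal

universe u v

variable {K : Type u} [DivisionRing K] {V W : Type v} [AddCommGroup V] [Module K V]
  [AddCommGroup W] [Module K W]

/-- The right ideal of the endomorphisms `r` of `V` for which `p ∘ r` has finite rank. -/
def finiteRankRightIdeal (p : V →ₗ[K] W) : Submodule (Module.End K V)ᵐᵒᵖ (Module.End K V) where
  carrier := {r | LinearMap.rank (p ∘ₗ r) < ℵ₀}
  zero_mem' := by simp [aleph0_pos]
  add_mem' {r s} hr hs := by
    rw [Set.mem_ofPred_eq, LinearMap.comp_add]
    exact (LinearMap.rank_add_le _ _).trans_lt (add_lt_aleph0 hr hs)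
  smul_mem' c r hr := (LinearMap.rank_comp_le_left c.unop (p ∘ₗ r)).trans_lt hr

theorem mem_finiteRankRightIdeal {p : V →ₗ[K] W} {r : Module.End K V} :
    r ∈ finiteRankRightIdeal p ↔ LinearMap.rank (p ∘ₗ r) < ℵ₀ :=
  Iff.rfl

theorem mem_finiteRankRightIdeal_of_rank_lt (p : V →ₗ[K] W) {r : Module.End K V}
    (hr : LinearMap.rank r < ℵ₀) : r ∈ finiteRankRightIdeal p :=
  (LinearMap.rank_comp_le_right r p).trans_lt hr

theorem exists_finite_rank_apply_eq_self (v : V) :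
    ∃ s : Module.End K V, LinearMap.rank s < ℵ₀ ∧ s v = v := by
  obtain ⟨q, hq⟩ := (K ∙ v).subtype.exists_leftInverse_of_injective (K ∙ v).ker_subtype
  refine ⟨(K ∙ v).subtype ∘ₗ q, ?_, ?_⟩
  · exact (LinearMap.rank_comp_le_left q _).trans_lt (by
      rw [LinearMap.rank, Submodule.range_subtype]
      exact Module.rank_lt_aleph0 K (K ∙ v))
  · exact congrArg Subtype.val
      (LinearMap.congr_fun hq ⟨v, Submodule.mem_span_singleton_self v⟩)

/-- If `finiteRankRightIdeal p` is automorphism-invariant, then it is stable under left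
multiplication by left-invertible endomorphisms. -/
theorem mul_mem_finiteRankRightIdeal {p : V →ₗ[K] W}
    (h : IsAutomorphismInvariant (Module.End K V)ᵐᵒᵖ (finiteRankRightIdeal p))
    {u w : Module.End K V} (huw : w * u = 1) {e : Module.End K V}
    (he : e ∈ finiteRankRightIdeal p) : u * e ∈ finiteRankRightIdeal p := by
  let I := finiteRankRightIdeal p
  let N : Submodule (Module.End K V)ᵐᵒᵖ I := (finiteRankRightIdeal LinearMap.id).comap I.subtype
  let f : N →ₗ[(Module.End K V)ᵐᵒᵖ] I :=
    { toFun := fun n => ⟨u * n.1.1, mem_finiteRankRightIdeal_of_rank_lt p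
        ((LinearMap.rank_comp_le_right n.1.1 u).trans_lt n.2)⟩
      map_add' := fun a b => Subtype.ext (mul_add u a.1.1 b.1.1)
      map_smul' := fun c a => Subtype.ext (mul_assoc u a.1.1 c.unop).symm }
  have hf : Function.Injective f := by
    intro a b hab
    have hab' : u * a.1.1 = u * b.1.1 := congrArg Subtype.val hab
    have := congrArg (w * ·) hab'
    simp only [← mul_assoc, huw, one_mul] at this
    exact Subtype.ext (Subtype.ext this)
  obtain ⟨g, hg⟩ := h N f hf
  suffices (g ⟨e, he⟩).1 = u * e from this ▸ (g ⟨e, he⟩).2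
  ext v
  obtain ⟨s, hs, hsv⟩ := exists_finite_rank_apply_eq_self (K := K) v
  have hes : MulOpposite.op s • (⟨e, he⟩ : I) ∈ N :=
    (LinearMap.rank_comp_le_right s e).trans_lt hs
  have key := congrArg Subtype.val (hg ⟨_, hes⟩)
  have hgs := congrArg Subtype.val (g.map_smul (MulOpposite.op s) ⟨e, he⟩)
  have := LinearMap.congr_fun (hgs.symm.trans key) v
  change (g ⟨e, he⟩).1 (s v) = u (e (s v)) at this
  rwa [hsv] at this

theorem IsRightARing.finite_of_end (h : IsRightARing (Module.End K V)) : Module.Finite K V := by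
  rw [← Module.rank_lt_aleph0_iff]
  by_contra! hV
  obtain ⟨φ⟩ : Nonempty (V ≃ₗ[K] V × V) :=
    nonempty_linearEquiv_of_rank_eq (by rw [rank_prod', add_eq_self hV])
  let p : V →ₗ[K] V := LinearMap.snd K V V ∘ₗ φ.toLinearMap
  let e : Module.End K V :=
    φ.symm.toLinearMap ∘ₗ LinearMap.inl K V V ∘ₗ LinearMap.fst K V V ∘ₗ φ.toLinearMap
  let u : Module.End K V :=
    φ.symm.toLinearMap ∘ₗ (LinearEquiv.prodComm K V V).toLinearMap ∘ₗ φ.toLinearMap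
  have huu : u * u = 1 := by ext v; simp [u]
  have he : e ∈ finiteRankRightIdeal p := by
    have : p ∘ₗ e = 0 := by ext v; simp [p, e]
    rw [mem_finiteRankRightIdeal, this]
    simp [aleph0_pos]
  have hue := mul_mem_finiteRankRightIdeal (h _) huu he
  have hpue : Function.Surjective (p ∘ₗ (u * e)) :=
    fun v => ⟨φ.symm (v, 0), by simp [p, u, e]⟩
  rw [mem_finiteRankRightIdeal, LinearMap.rank, LinearMap.range_eq_top.2 hpue, rank_top] at hue
  exact hV.not_gt hue

end

/-- the endomorphism ring of a right vector space `V` over a division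
ring `D` (i.e. of a left `Dᵐᵒᵖ`-module) is a right `a`-ring iff `V` is
finite-dimensional. -/
theorem endRing_rightARing_iff_finiteDimensional (D : Type*) [DivisionRing D]
    (V : Type*) [AddCommGroup V] [Module Dᵐᵒᵖ V] :
    IsRightARing (Module.End Dᵐᵒᵖ V) ↔ Module.Finite Dᵐᵒᵖ V := by
  refine ⟨IsRightARing.finite_of_end, fun _ I => ?_⟩
  have := IsSemisimpleRing.moduleEnd Dᵐᵒᵖ V
  exact IsSemisimpleModule.isAutomorphismInvariant _ _
end

section
/- Every simple right a-ring is artinian; that is, a simple ring which is a right a-ring is simple artinian. -/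
section AutomorphismInvariant

variable {A M N P : Type*} [Ring A] [AddCommGroup M] [Module A M] [AddCommGroup N] [Module A N]
  [AddCommGroup P] [Module A P]

theorem IsAutomorphismInvariant.exists_comp_eq (hM : IsAutomorphismInvariant A M)
    (j h : P →ₗ[A] M) (hj : Function.Injective j) (hh : Function.Injective h) :
    ∃ g : M →ₗ[A] M, g ∘ₗ j = h := by
  let e := LinearEquiv.ofInjective j hj
  obtain ⟨g, hg⟩ := hM (LinearMap.range j) (h ∘ₗ e.symm.toLinearMap)
    (hh.comp e.symm.injective)
  refine ⟨g, LinearMap.ext fun x ↦ ?_⟩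
  simpa [e] using hg (e x)

theorem IsAutomorphismInvariant.congr (e : M ≃ₗ[A] N) (hM : IsAutomorphismInvariant A M) :
    IsAutomorphismInvariant A N := by
  intro K f hf
  obtain ⟨g, hg⟩ := hM.exists_comp_eq (e.symm.toLinearMap ∘ₗ K.subtype)
    (e.symm.toLinearMap ∘ₗ f) (e.symm.injective.comp K.injective_subtype)
    (e.symm.injective.comp hf)
  refine ⟨e.toLinearMap ∘ₗ g ∘ₗ e.symm.toLinearMap, fun n ↦ ?_⟩
  simpa using congrArg e (LinearMap.congr_fun hg n)

/-- If `M × N` is automorphism-invariant, then `M` is injective relative to `N`. -/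
theorem IsAutomorphismInvariant.exists_extend_of_prod
    (h : IsAutomorphismInvariant A (M × N)) (K : Submodule A N) (f : K →ₗ[A] M) :
    ∃ g : N →ₗ[A] M, ∀ k : K, g k = f k := by
  obtain ⟨g, hg⟩ := h.exists_comp_eq (LinearMap.id.prodMap K.subtype)
    ((LinearMap.id.coprod f).prod (K.subtype ∘ₗ LinearMap.snd A M K))
    (fun x y hxy ↦ by simpa [Prod.ext_iff] using hxy)
    (fun x y hxy ↦ by
      obtain ⟨h₁, h₂⟩ : x.1 + f x.2 = y.1 + f y.2 ∧ x.2 = y.2 := by simpa using hxy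
      rw [h₂] at h₁
      exact Prod.ext (add_right_cancel h₁) h₂)
  refine ⟨LinearMap.fst A M N ∘ₗ g ∘ₗ LinearMap.inr A M N, fun k ↦ ?_⟩
  simpa using congrArg Prod.fst (LinearMap.congr_fun hg (0, k))

theorem isSemisimpleModule_of_isAutomorphismInvariant_prod
    (h : ∀ K : Submodule A N, IsAutomorphismInvariant A (K × N)) : IsSemisimpleModule A N where
  exists_isCompl K := by
    obtain ⟨g, hg⟩ := (h K).exists_extend_of_prod K LinearMap.id
    exact ⟨LinearMap.ker g, LinearMap.isCompl_of_proj hg⟩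

end AutomorphismInvariant

section RightARing

variable {R : Type*} [Ring R]

theorem IsRightARing.isAutomorphismInvariant (hR : IsRightARing R) {M : Type*} [AddCommGroup M]
    [Module Rᵐᵒᵖ M] (k : M →ₗ[Rᵐᵒᵖ] R) (hk : Function.Injective k) :
    IsAutomorphismInvariant Rᵐᵒᵖ M :=
  (hR (LinearMap.range k)).congr (LinearEquiv.ofInjective k hk).symm

/-- In a right `a`-ring, a right ideal that is isomorphic to a right ideal independent of it is
semisimple. -/
theorem IsRightARing.isSemisimpleModule_of_disjoint (hR : IsRightARing R)
    (N : Submodule Rᵐᵒᵖ R) (φ : N →ₗ[Rᵐᵒᵖ] R) (hφ : Function.Injective φ)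
    (hd : Disjoint (LinearMap.range φ) N) : IsSemisimpleModule Rᵐᵒᵖ N := by
  refine isSemisimpleModule_of_isAutomorphismInvariant_prod fun K ↦
    hR.isAutomorphismInvariant ((φ ∘ₗ K.subtype).coprod N.subtype) ?_
  refine (injective_iff_map_eq_zero _).2 fun x hx ↦ ?_
  have hx' : φ x.1 + (x.2 : R) = 0 := by simpa using hx
  have h₀ : φ x.1 = 0 := by
    refine Submodule.disjoint_def.1 hd _ ⟨_, rfl⟩ ?_
    rw [eq_neg_of_add_eq_zero_left hx']
    exact N.neg_mem x.2.2
  rw [h₀, zero_add] at hx'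
  rw [← φ.map_zero] at h₀
  exact Prod.ext (Subtype.ext (hφ h₀)) (Subtype.ext hx')

theorem IsSimpleRing.one_of_mul_closed [IsSimpleRing R] {p : R → Prop}
    (hadd : ∀ x y, p x → p y → p (x + y)) (hleft : ∀ z x, p x → p (z * x))
    (hright : ∀ x z, p x → p (x * z)) {x : R} (hx : p x) (hx₀ : x ≠ 0) : p 1 := by
  let I : TwoSidedIdeal R := TwoSidedIdeal.mk' {x | p x}
    (by simpa using hleft 0 x hx) (hadd _ _) (fun h ↦ by simpa using hleft (-1) _ h)
    (hleft _ _) (hright _ _)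
  simpa [I] using IsSimpleRing.one_mem_of_ne_zero_mem I hx₀ (by simpa [I] using hx)

theorem IsSimpleRing.exists_mul_mul_ne_zero [IsSimpleRing R] {b a : R} (hb : b ≠ 0)
    (ha : a ≠ 0) : ∃ t, b * t * a ≠ 0 := by
  by_contra! h
  have h₁ := IsSimpleRing.one_of_mul_closed (p := fun x ↦ ∀ t, b * t * x = 0)
    (fun x y hx hy t ↦ by rw [mul_add, hx, hy, add_zero])
    (fun z x hx t ↦ by simpa [mul_assoc] using hx (t * z))
    (fun x z hx t ↦ by rw [← mul_assoc, hx, zero_mul]) h ha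
  exact hb (by simpa using h₁ 1)

/-- A simple ring is right nonsingular. -/
theorem IsSimpleRing.exists_mul_eq_zero_imp [IsSimpleRing R] {x : R} (hx : x ≠ 0) :
    ∃ y ≠ 0, ∀ r, x * (y * r) = 0 → y * r = 0 := by
  by_contra! h
  have h₁ := IsSimpleRing.one_of_mul_closed
    (p := fun x : R ↦ ∀ y ≠ 0, ∃ r, x * (y * r) = 0 ∧ y * r ≠ 0)
    (fun x x' hx hx' y hy ↦ by
      obtain ⟨r, hr, hr₀⟩ := hx y hy
      obtain ⟨s, hs, hs₀⟩ := hx' (y * r) hr₀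
      refine ⟨r * s, ?_, by rwa [← mul_assoc]⟩
      rw [← mul_assoc y, add_mul, hs, add_zero, ← mul_assoc, hr, zero_mul])
    (fun z x hx y hy ↦ by
      obtain ⟨r, hr, hr₀⟩ := hx y hy
      exact ⟨r, by rw [mul_assoc, hr, mul_zero], hr₀⟩)
    (fun x z hx y hy ↦ by
      by_cases hzy : z * y = 0
      · exact ⟨1, by simp [mul_assoc, hzy], by simpa⟩
      · obtain ⟨r, hr, hr₀⟩ := hx (z * y) hzy
        rw [mul_assoc z] at hr hr₀
        exact ⟨r, by rwa [mul_assoc], right_ne_zero_of_mul hr₀⟩) h hx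
  obtain ⟨r, hr, hr₀⟩ := h₁ 1 one_ne_zero
  exact hr₀ (by simpa using hr)

theorem IsSimpleRing.isSemisimpleModule_of_mem [IsSimpleRing R] {N : Submodule Rᵐᵒᵖ R}
    (hN : IsSemisimpleModule Rᵐᵒᵖ N) {x : R} (hxN : x ∈ N) (hx : x ≠ 0) :
    IsSemisimpleModule Rᵐᵒᵖ R := by
  obtain ⟨S, hS, h₁⟩ := IsSimpleRing.one_of_mul_closed
    (p := fun x : R ↦ ∃ S : Submodule Rᵐᵒᵖ R, IsSemisimpleModule Rᵐᵒᵖ S ∧ x ∈ S)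
    (fun x y ⟨S, hS, hx⟩ ⟨T, hT, hy⟩ ↦
      ⟨S ⊔ T, IsSemisimpleModule.sup hS hT, Submodule.add_mem_sup hx hy⟩)
    (fun z x ⟨S, hS, hx⟩ ↦ ⟨LinearMap.range (LinearMap.mulLeft Rᵐᵒᵖ z ∘ₗ S.subtype),
      IsSemisimpleModule.range _, ⟨⟨x, hx⟩, rfl⟩⟩)
    (fun x z ⟨S, hS, hx⟩ ↦ ⟨S, hS, S.smul_mem (MulOpposite.op z) hx⟩) ⟨N, hN, hxN⟩ hx
  have hS' : S = ⊤ := eq_top_iff.2 fun r _ ↦ by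
    simpa using S.smul_mem (MulOpposite.op r) h₁
  subst hS'
  exact IsSemisimpleModule.congr Submodule.topEquiv.symm

/-- A simple right `a`-ring with two nonzero independent right ideals is semisimple. -/
theorem IsRightARing.isSemisimpleModule_of_independent [IsSimpleRing R] (hR : IsRightARing R)
    {a b : R} (ha : a ≠ 0) (hb : b ≠ 0) (hab : ∀ r s, b * r = a * s → b * r = 0) :
    IsSemisimpleModule Rᵐᵒᵖ R := by
  obtain ⟨t, ht⟩ := IsSimpleRing.exists_mul_mul_ne_zero hb ha
  obtain ⟨y, hy, hinj⟩ := IsSimpleRing.exists_mul_eq_zero_imp ht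
  let N : Submodule Rᵐᵒᵖ R := LinearMap.range (LinearMap.mulLeft Rᵐᵒᵖ (a * y))
  have hay : a * y ≠ 0 := fun h ↦ hy (by simpa using hinj 1 (by simp [mul_assoc, h]))
  refine IsSimpleRing.isSemisimpleModule_of_mem (N := N) (x := a * y)
    (hR.isSemisimpleModule_of_disjoint N (LinearMap.mulLeft Rᵐᵒᵖ (b * t) ∘ₗ N.subtype) ?_ ?_)
    ⟨1, by simp⟩ hay
  · refine (injective_iff_map_eq_zero _).2 ?_
    rintro ⟨_, r, rfl⟩ h
    have h' : y * r = 0 := hinj r (by simpa [mul_assoc] using h)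
    exact Subtype.ext (by simp [h'])
  · refine Submodule.disjoint_def.2 ?_
    rintro _ ⟨⟨u, _⟩, rfl⟩ ⟨s, hs⟩
    have hs' : a * (y * s) = b * (t * u) := by simpa [mul_assoc] using hs
    simpa [mul_assoc] using hab (t * u) (y * s) hs'.symm

theorem IsRightARing.exists_mul_eq_one (hR : IsRightARing R) {x : R}
    (hx : ∀ z, x * z = 0 → z = 0) : ∃ b, b * x = 1 := by
  obtain ⟨g, hg⟩ := (hR.isAutomorphismInvariant LinearMap.id
    Function.injective_id).exists_comp_eq (LinearMap.mulLeft Rᵐᵒᵖ x) LinearMap.id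
    ((injective_iff_map_eq_zero _).2 fun z hz ↦ hx z (by simpa using hz)) Function.injective_id
  refine ⟨g 1, ?_⟩
  have h₁ : g x = 1 := by simpa using LinearMap.congr_fun hg 1
  have h₂ := g.map_smul (MulOpposite.op x) 1
  simpa [h₁] using h₂.symm

theorem isSimpleModule_mulOpposite_of_exists_mul_eq_one [Nontrivial R]
    (h : ∀ x : R, x ≠ 0 → ∃ b, b * x = 1) : IsSimpleModule Rᵐᵒᵖ R := by
  have hinv : ∀ x : R, x ≠ 0 → ∃ b, x * b = 1 := fun x hx ↦ by
    obtain ⟨b, hb⟩ := h x hx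
    obtain ⟨c, hc⟩ := h b (left_ne_zero_of_mul (hb.trans_ne one_ne_zero))
    exact ⟨b, by rwa [← left_inv_eq_right_inv hc hb]⟩
  refine isSimpleModule_iff_toSpanSingleton_surjective.2 ⟨inferInstance, fun x hx r ↦ ?_⟩
  obtain ⟨b, hb⟩ := hinv x hx
  exact ⟨MulOpposite.op (b * r), by simp [← mul_assoc, hb]⟩

end RightARing

/-- every simple right `a`-ring is artinian. -/
theorem simple_rightARing_isArtinian (R : Type*) [Ring R]
    (hsimple : IsSimpleRing R) (hR : IsRightARing R) :
    IsArtinian Rᵐᵒᵖ R := by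
  have : Module.Finite Rᵐᵒᵖ R :=
    Module.Finite.of_surjective (LinearMap.toSpanSingleton Rᵐᵒᵖ R 1)
      fun r ↦ ⟨MulOpposite.op r, by simp⟩
  suffices IsSemisimpleModule Rᵐᵒᵖ R from inferInstance
  by_cases hunif : ∃ a b : R, a ≠ 0 ∧ b ≠ 0 ∧ ∀ r s, b * r = a * s → b * r = 0
  · obtain ⟨a, b, ha, hb, hab⟩ := hunif
    exact hR.isSemisimpleModule_of_independent ha hb hab
  push Not at hunif
  suffices IsSimpleModule Rᵐᵒᵖ R from inferInstance
  refine isSimpleModule_mulOpposite_of_exists_mul_eq_one fun x hx ↦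
    hR.exists_mul_eq_one fun z hz ↦ ?_
  obtain ⟨y, hy, hinj⟩ := IsSimpleRing.exists_mul_eq_zero_imp hx
  by_contra hz₀
  obtain ⟨r, s, hrs, hr₀⟩ := hunif z y hz₀ hy
  exact hr₀ (hinj r (by rw [hrs, ← mul_assoc, hz, zero_mul]))
end

section
/- Every CS automorphism-invariant module is quasi-injective; in particular, a ring R that is right CS and right automorphism-invariant (R is automorphism-invariant as a right module over itself) is right self-injective. -/
/-- In a CS module every submodule `N` admits an idempotent endomorphism `p` fixing `N`
pointwise such that the preimage of `N` under `p` is essential. -/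
theorem IsCSModule.exists_projection {A : Type*} [Ring A] {M : Type*} [AddCommGroup M]
    [Module A M] (h : IsCSModule A M) (N : Submodule A M) :
    ∃ p : M →ₗ[A] M, (∀ x, p (p x) = p x) ∧ (∀ x ∈ N, p x = x) ∧
      ∀ L : Submodule A M, L ⊓ N.comap p = ⊥ → L = ⊥ := by
  obtain ⟨D, ⟨D', hD⟩, hND, hess⟩ := h N
  obtain ⟨p, hpD, hpx⟩ : ∃ p : M →ₗ[A] M, (∀ x, p x ∈ D) ∧ ∀ x ∈ D, p x = x :=
    ⟨D.subtype ∘ₗ D.projectionOnto D' hD, fun x => by simp, fun x hx =>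
      congrArg Subtype.val (Submodule.projectionOnto_apply_left hD ⟨x, hx⟩)⟩
  refine ⟨p, fun x => hpx _ (hpD x), fun x hx => hpx x (hND hx), fun L hL => ?_⟩
  have hmap : L.map p = ⊥ := by
    refine hess _ (Submodule.map_le_iff_le_comap.2 fun x _ => hpD x) ?_
    rw [Submodule.eq_bot_iff] at hL ⊢
    rintro _ ⟨⟨x, hx, rfl⟩, hxN⟩
    rw [hL x ⟨hx, hxN⟩, map_zero]
  rw [← hL, eq_comm, inf_eq_left]
  intro x hx
  have hpx0 : p x = 0 := (Submodule.eq_bot_iff _).1 hmap _ (Submodule.mem_map_of_mem hx)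
  simp [hpx0]

/-- In an automorphism-invariant module, a linear map from a submodule extends whenever it
vanishes on an essential part of its domain: adding the inclusion makes it injective. -/
theorem IsAutomorphismInvariant.exists_extension_of_essential_ker {A : Type*} [Ring A]
    {M : Type*} [AddCommGroup M] [Module A M] (h : IsAutomorphismInvariant A M)
    (N : Submodule A M) (f : N →ₗ[A] M)
    (hf : ∀ L : Submodule A N, L ⊓ LinearMap.ker f = ⊥ → L = ⊥) :
    ∃ g : M →ₗ[A] M, ∀ n : N, g n = f n := by
  obtain ⟨g, hg⟩ := h N (f + N.subtype) <| by
    rw [← LinearMap.ker_eq_bot]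
    refine hf _ ((Submodule.eq_bot_iff _).2 ?_)
    rintro x ⟨hx, hfx⟩
    simpa [LinearMap.mem_ker.1 hfx] using hx
  exact ⟨g - LinearMap.id, fun n => by simp [hg]⟩

theorem IsCSModule.isQuasiInjective {A : Type*} [Ring A] {M : Type*} [AddCommGroup M]
    [Module A M] (hCS : IsCSModule A M) (hAut : IsAutomorphismInvariant A M) :
    IsQuasiInjective A M := by
  suffices key : ∀ (N : Submodule A M) (f : N →ₗ[A] M),
      (∀ L : Submodule A M, L ⊓ N = ⊥ → L = ⊥) → ∃ g : M →ₗ[A] M, ∀ n : N, g n = f n by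
    intro N f
    obtain ⟨p, -, hpN, hess⟩ := hCS.exists_projection N
    obtain ⟨g, hg⟩ := key (N.comap p) (f ∘ₗ p.restrict fun _ hx => hx) hess
    refine ⟨g, fun n => ?_⟩
    have hn : (n : M) ∈ N.comap p := by simp [hpN n n.2]
    refine (hg ⟨n, hn⟩).trans (congrArg f (Subtype.ext ?_))
    exact hpN n n.2
  intro N f hN
  let K : Submodule A M := (LinearMap.ker f).map N.subtype
  have hK : ∀ x (hx : x ∈ K), ∃ hxN : x ∈ N, f ⟨x, hxN⟩ = 0 := by
    rintro _ ⟨y, hy, rfl⟩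
    exact ⟨y.2, hy⟩
  obtain ⟨p, hpp, hpK, hess⟩ := hCS.exists_projection K
  -- `f` is injective on the part of its domain lying in the complementary summand `ker p`.
  obtain ⟨g, hg⟩ := hAut (N ⊓ LinearMap.ker p) (f ∘ₗ Submodule.inclusion inf_le_left) <| by
    rw [← LinearMap.ker_eq_bot, Submodule.eq_bot_iff]
    intro x hx
    have hxK : (x : M) ∈ K := ⟨⟨x, x.2.1⟩, hx, rfl⟩
    exact Subtype.ext ((hpK x hxK).symm.trans x.2.2)
  obtain ⟨k, hk⟩ := hAut.exists_extension_of_essential_ker N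
    (f - g ∘ₗ (LinearMap.id - p) ∘ₗ N.subtype) <| by
    intro L hL
    suffices hLM : L.map N.subtype = ⊥ by
      exact Submodule.map_injective_of_injective N.injective_subtype
        (hLM.trans (Submodule.map_bot _).symm)
    refine hess _ ((Submodule.eq_bot_iff _).2 ?_)
    rintro _ ⟨⟨x, hx, rfl⟩, hxK⟩
    obtain ⟨hpxN, hfpx⟩ := hK (p x) hxK
    suffices hx0 : x = 0 by simp [hx0]
    refine (Submodule.eq_bot_iff _).1 hL x ⟨hx, ?_⟩
    have hg' := hg ⟨x - p x, N.sub_mem x.2 hpxN, by simp [hpp]⟩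
    have hsub : f (x - ⟨p x, hpxN⟩) = g (x - p x) := hg'.symm
    rw [map_sub, hfpx, sub_zero] at hsub
    simp [hsub]
  exact ⟨k + g ∘ₗ (LinearMap.id - p), fun n => by simp [hk]⟩

/-- Baer's criterion: a ring that is quasi-injective as a right module over itself is right
self-injective. -/
theorem IsQuasiInjective.injective_mulOpposite {R : Type*} [Ring R]
    (h : IsQuasiInjective Rᵐᵒᵖ R) : Module.Injective Rᵐᵒᵖ R := by
  refine Module.Baer.injective fun I f => ?_
  let e : R →ₗ[Rᵐᵒᵖ] Rᵐᵒᵖ :=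
    { toFun := MulOpposite.op
      map_add' := fun _ _ => rfl
      map_smul' := fun _ _ => rfl }
  let e' : Rᵐᵒᵖ →ₗ[Rᵐᵒᵖ] R :=
    { toFun := MulOpposite.unop
      map_add' := fun _ _ => rfl
      map_smul' := fun _ _ => rfl }
  obtain ⟨g, hg⟩ := h (Submodule.comap e I) (f ∘ₗ e.restrict fun _ hx => hx)
  exact ⟨g ∘ₗ e', fun x hx => hg ⟨x.unop, hx⟩⟩

/-- every CS automorphism-invariant module is quasi-injective; in
particular a right CS right automorphism-invariant ring is right self-injective. -/
theorem cs_automorphismInvariant_quasiInjective :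
    (∀ (A : Type*) [Ring A] (M : Type*) [AddCommGroup M] [Module A M],
        IsCSModule A M → IsAutomorphismInvariant A M → IsQuasiInjective A M) ∧
    (∀ (R : Type*) [Ring R],
        IsCSModule Rᵐᵒᵖ R → IsAutomorphismInvariant Rᵐᵒᵖ R →
          Module.Injective Rᵐᵒᵖ R) :=
  ⟨fun _ _ _ _ _ hCS hAut => hCS.isQuasiInjective hAut,
    fun _ _ hCS hAut => (hCS.isQuasiInjective hAut).injective_mulOpposite⟩
end
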